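/- If Γ is a finite simplicial graph focused at a vertex c, with trivial graph automorphism group, n = |V| vertices, and V \ st(c) nonempty, then Out(A_Γ) contains a normal subgroup of finite index 2^n that is isomorphic to the free abelian group ℤ^{k+m−1}; in particular Out(A_Γ) is virtually free abelian of rank k + m − 1. -/

import Mathlib

noncomputable section

/-- The subgroup of inner automorphisms inside `MulAut G`. -/
def Inn (G : Type) [Group G] : Subgroup (MulAut G) :=
  (MulAut.conj : G →* MulAut G).range

instance Inn.normal (G : Type) [Group G] : (Inn G).Normal := by
  constructor
  rintro x ⟨g, rfl⟩ φ
  refine ⟨φ g, ?_⟩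
  ext h
  simp [MulAut.mul_apply, MulAut.conj_apply, map_mul, map_inv]

/-- The outer automorphism group of `G`. -/
abbrev Out (G : Type) [Group G] := MulAut G ⧸ Inn G

/-- The set of commutator relators defining the RAAG of a graph. -/
def raagRels {V : Type} (G : SimpleGraph V) : Set (FreeGroup V) :=
  {r | ∃ u v : V, G.Adj u v ∧
    r = FreeGroup.of u * FreeGroup.of v * (FreeGroup.of u)⁻¹ * (FreeGroup.of v)⁻¹}

/-- The right-angled Artin group of a graph. -/
abbrev RAAG {V : Type} (G : SimpleGraph V) := PresentedGroup (raagRels G)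

/-- The standard generator of `RAAG G` corresponding to a vertex. -/
def gen {V : Type} (G : SimpleGraph V) (v : V) : RAAG G := PresentedGroup.of v

/-- The star of a vertex: the vertex together with its neighbours. -/
def star {V : Type} (G : SimpleGraph V) (v : V) : Set V := insert v (G.neighborSet v)

/-- `u` dominates `v` if `lk(v) ⊆ st(u)`. -/
def Dominates {V : Type} (G : SimpleGraph V) (u v : V) : Prop :=
  G.neighborSet v ⊆ star G u

/-- A graph has trivial automorphism group. -/
def TrivialAut {V : Type} (G : SimpleGraph V) : Prop := ∀ e : G ≃g G, ∀ v, e v = v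

/-- A graph is focused at a vertex `c`. -/
def Focused {V : Type} (G : SimpleGraph V) (c : V) : Prop :=
  (∀ u v : V, u ≠ v → Dominates G u v → u = c) ∧
  ∀ v : V, v ≠ c → (G.induce (star G v)ᶜ).Connected

/-- A graph is austere. -/
def Austere {V : Type} (G : SimpleGraph V) : Prop :=
  TrivialAut G ∧ (∀ u v : V, u ≠ v → ¬Dominates G u v) ∧
  ∀ v : V, (G.induce (star G v)ᶜ).Connected

/-- `P` is (the vertex set of) a connected component of the induced subgraph on `s`. -/
def IsCompOf {V : Type} (G : SimpleGraph V) (s : Set V) (P : Set V) : Prop :=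
  ∃ x : s, P = Subtype.val '' {y : s | (G.induce s).Reachable x y}

/-- `φ` is the inversion at the vertex `v`. -/
def IsInversion {V : Type} (G : SimpleGraph V) (φ : MulAut (RAAG G)) (v : V) : Prop :=
  φ (gen G v) = (gen G v)⁻¹ ∧ ∀ w : V, w ≠ v → φ (gen G w) = gen G w

/-- `φ` is the transvection `τ_{uv}` (`v ↦ uv`). -/
def IsTransvection {V : Type} (G : SimpleGraph V) (φ : MulAut (RAAG G)) (u v : V) : Prop :=
  u ≠ v ∧ Dominates G u v ∧ φ (gen G v) = gen G u * gen G v ∧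
    ∀ w : V, w ≠ v → φ (gen G w) = gen G w

/-- `φ` is the partial conjugation `χ_{v,P}`. -/
def IsPartialConj {V : Type} (G : SimpleGraph V) (φ : MulAut (RAAG G)) (v : V) (P : Set V) :
    Prop :=
  IsCompOf G (star G v)ᶜ P ∧ (∀ u ∈ P, φ (gen G u) = gen G v * gen G u * (gen G v)⁻¹) ∧
    ∀ w : V, w ∉ P → φ (gen G w) = gen G w

/-- The subgroup `I_Γ` of `Aut(A_Γ)` generated by the inversions. -/
def InvSubgroup {V : Type} (G : SimpleGraph V) : Subgroup (MulAut (RAAG G)) :=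
  Subgroup.closure {φ | ∃ v, IsInversion G φ v}

/-- The subgroup `PCT` of `Aut(A_Γ)` generated by transvections and partial conjugations. -/
def PCT {V : Type} (G : SimpleGraph V) : Subgroup (MulAut (RAAG G)) :=
  Subgroup.closure {φ | (∃ u v, IsTransvection G φ u v) ∨ ∃ v P, IsPartialConj G φ v P}

/-- The number `l` of vertices dominated by but not adjacent to `c`. -/
def lInv {V : Type} (G : SimpleGraph V) (c : V) : ℕ :=
  Nat.card {v : V | v ≠ c ∧ Dominates G c v ∧ ¬G.Adj c v}

/-- The number `m` of vertices (other than `c`) dominated by `c`. -/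
def mInv {V : Type} (G : SimpleGraph V) (c : V) : ℕ :=
  Nat.card {v : V | v ≠ c ∧ Dominates G c v}

/-- The number `k` of connected components of `Γ \ st(c)`. -/
def kInv {V : Type} (G : SimpleGraph V) (c : V) : ℕ :=
  Nat.card ((G.induce (star G c)ᶜ).ConnectedComponent)

/-- `GL_n(ℤ)`. -/
abbrev GLZ (n : ℕ) := Matrix.GeneralLinearGroup (Fin n) ℤ

/-- `PGL_n(ℤ)`, the quotient of `GL_n(ℤ)` by its centre `{±I}`. -/
abbrev PGLZ (n : ℕ) := GLZ n ⧸ Subgroup.center (GLZ n)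

/-- The principal level 2 congruence subgroup `Λ_l[2]` of `GL_l(ℤ)`. -/
def congr2 (l : ℕ) : Subgroup (GLZ l) :=
  (Matrix.GeneralLinearGroup.map (Int.castRingHom (ZMod 2)) :
    GLZ l →* Matrix.GeneralLinearGroup (Fin l) (ZMod 2)).ker

/-- The matrix `(1 1 / 0 -1)`. -/
def Bmat : Matrix (Fin 2) (Fin 2) ℤ := !![1, 1; 0, -1]

/-- A block-diagonal `2l × 2l` matrix whose `i`th `2 × 2` diagonal block is
`Bmat` if `ε i` and the identity otherwise. -/
def Lmat (l : ℕ) (ε : Fin l → Bool) : Matrix (Fin l × Fin 2) (Fin l × Fin 2) ℤ :=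
  fun a b =>
    if a.1 = b.1 then (if ε a.1 then Bmat a.2 b.2 else (1 : Matrix (Fin 2) (Fin 2) ℤ) a.2 b.2)
    else 0

/-- `GL_{2l}(ℤ)`, with rows and columns indexed by `Fin l × Fin 2`. -/
abbrev GL2l (l : ℕ) := Matrix.GeneralLinearGroup (Fin l × Fin 2) ℤ

/-- The subgroup `𝓛 ≤ GL_{2l}(ℤ)`. -/
def scriptL (l : ℕ) : Subgroup (GL2l l) :=
  Subgroup.closure {M : GL2l l |
    ∃ ε : Fin l → Bool, (M : Matrix (Fin l × Fin 2) (Fin l × Fin 2) ℤ) = Lmat l ε}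

/-- The index type realizing the block decomposition `d = 2l + p + q`. -/
abbrev BIdx (l p q : ℕ) := (Fin l × Fin 2) ⊕ (Fin p ⊕ Fin q)

/-- The block-diagonal matrix `Diag(D₁, D₂, ε·I_q)` with `D₁ ∈ 𝓛` given by `ε1`,
`D₂` diagonal with entries `d2`, and `ε = e`. -/
def Dmat (l p q : ℕ) (ε1 : Fin l → Bool) (d2 : Fin p → ℤˣ) (e : ℤˣ) :
    Matrix (BIdx l p q) (BIdx l p q) ℤ := fun a b =>
  match a, b with
  | Sum.inl a, Sum.inl b => Lmat l ε1 a b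
  | Sum.inr (Sum.inl i), Sum.inr (Sum.inl j) => if i = j then (d2 i : ℤ) else 0
  | Sum.inr (Sum.inr i), Sum.inr (Sum.inr j) => if i = j then (e : ℤ) else 0
  | _, _ => 0

/-- The subgroup `D ≤ GL_d(ℤ)` generated by `−I_d` and the block-diagonal matrices
`Diag(D₁, D₂, ε·I_q)`. -/
def DSub (l p q : ℕ) : Subgroup (Matrix.GeneralLinearGroup (BIdx l p q) ℤ) :=
  Subgroup.closure
    ({M | (M : Matrix (BIdx l p q) (BIdx l p q) ℤ) = -1} ∪
     {M | ∃ ε1 d2 e, (M : Matrix (BIdx l p q) (BIdx l p q) ℤ) = Dmat l p q ε1 d2 e})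

namespace RAAG

open scoped Pointwise

section Basic

variable {V : Type} {G : SimpleGraph V}

theorem gen_commute {u v : V} (h : G.Adj u v) : Commute (gen G u) (gen G v) := by
  have : (PresentedGroup.mk (raagRels G)) (FreeGroup.of u * FreeGroup.of v *
      (FreeGroup.of u)⁻¹ * (FreeGroup.of v)⁻¹) = 1 :=
    PresentedGroup.one_of_mem ⟨u, v, h, rfl⟩
  simp only [map_mul, map_inv] at this
  rw [mul_inv_eq_one, mul_inv_eq_iff_eq_mul] at this
  exact this

/-- The homomorphism out of a right-angled Artin group given by the images of the generators. -/
def lift {K : Type*} [Group K] (f : V → K) (h : ∀ u v, G.Adj u v → Commute (f u) (f v)) :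
    RAAG G →* K :=
  PresentedGroup.toGroup (f := f) (by
    rintro r ⟨u, v, huv, rfl⟩
    simp only [map_mul, map_inv, FreeGroup.lift_apply_of]
    rw [mul_inv_eq_one, mul_inv_eq_iff_eq_mul]
    exact h u v huv)

@[simp] theorem lift_gen {K : Type*} [Group K] (f : V → K)
    (h : ∀ u v, G.Adj u v → Commute (f u) (f v)) (v : V) : lift f h (gen G v) = f v :=
  PresentedGroup.toGroup.of _

theorem closure_gen : Subgroup.closure (Set.range (gen G)) = ⊤ :=
  PresentedGroup.closure_range_of _

theorem hom_ext {K : Type*} [Group K] {f g : RAAG G →* K}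
    (h : ∀ v, f (gen G v) = g (gen G v)) : f = g :=
  PresentedGroup.ext h

theorem aut_ext {f g : MulAut (RAAG G)} (h : ∀ v, f (gen G v) = g (gen G v)) : f = g := by
  have : f.toMonoidHom = g.toMonoidHom := hom_ext h
  ext x
  exact DFunLike.congr_fun this x

/-- The subgroup generated by a set of vertices. -/
def sub (G : SimpleGraph V) (S : Set V) : Subgroup (RAAG G) := Subgroup.closure (gen G '' S)

theorem gen_mem_sub {S : Set V} {v : V} (h : v ∈ S) : gen G v ∈ sub G S :=
  Subgroup.subset_closure ⟨v, h, rfl⟩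

theorem sub_mono {S T : Set V} (h : S ⊆ T) : sub G S ≤ sub G T :=
  Subgroup.closure_mono (Set.image_mono h)

theorem sub_univ : sub G Set.univ = ⊤ := by
  rw [sub, Set.image_univ, closure_gen]

@[elab_as_elim]
theorem sub_induction_right {S : Set V} {P : (g : RAAG G) → g ∈ sub G S → Prop}
    (one : P 1 (one_mem _))
    (mul : ∀ (g) (hg : g ∈ sub G S) (v) (hv : v ∈ S), P g hg →
      P (g * gen G v) (mul_mem hg (gen_mem_sub hv)))
    (inv : ∀ (g) (hg : g ∈ sub G S) (v) (hv : v ∈ S), P g hg →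
      P (g * (gen G v)⁻¹) (mul_mem hg (inv_mem (gen_mem_sub hv)))) {g : RAAG G}
    (hg : g ∈ sub G S) : P g hg := by
  refine Subgroup.closure_induction_right (p := P) one ?_ ?_ hg
  · rintro x hx _ ⟨v, hv, rfl⟩ h; exact mul x hx v hv h
  · rintro x hx _ ⟨v, hv, rfl⟩ h; exact inv x hx v hv h

@[elab_as_elim]
theorem induction_right {P : RAAG G → Prop} (one : P 1)
    (mul : ∀ g v, P g → P (g * gen G v))
    (inv : ∀ g v, P g → P (g * (gen G v)⁻¹)) (g : RAAG G) : P g := by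
  have hg : g ∈ sub G Set.univ := by rw [sub_univ]; trivial
  induction hg using sub_induction_right with
  | one => exact one
  | mul g _ v _ h => exact mul g v h
  | inv g _ v _ h => exact inv g v h

theorem commute_of_mem_sub_lk {v : V} {k : RAAG G} (hk : k ∈ sub G (G.neighborSet v)) :
    Commute k (gen G v) := by
  induction hk using sub_induction_right with
  | one => exact Commute.one_left _
  | mul g _ w hw h => exact h.mul_left (gen_commute (SimpleGraph.Adj.symm hw))
  | inv g _ w hw h => exact h.mul_left (gen_commute (SimpleGraph.Adj.symm hw)).inv_left

open Classical in
/-- The exponent sum homomorphism of a generator. -/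
def expHom (G : SimpleGraph V) (w : V) : RAAG G →* Multiplicative ℤ :=
  lift (fun v => Multiplicative.ofAdd (if v = w then 1 else 0)) (fun _ _ _ => Commute.all _ _)

/-- The exponent sum of a generator in an element. -/
def ex (w : V) (g : RAAG G) : ℤ := (expHom G w g).toAdd

@[simp] theorem ex_one (w : V) : ex w (1 : RAAG G) = 0 := by simp [ex]

@[simp] theorem ex_mul (w : V) (g h : RAAG G) : ex w (g * h) = ex w g + ex w h := by simp [ex]

@[simp] theorem ex_inv (w : V) (g : RAAG G) : ex w g⁻¹ = -ex w g := by simp [ex]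

@[simp] theorem ex_zpow (w : V) (g : RAAG G) (n : ℤ) : ex w (g ^ n) = n * ex w g := by simp [ex]

open Classical in
theorem ex_gen (w v : V) : ex w (gen G v) = if v = w then 1 else 0 := by simp [ex, expHom]

@[simp] theorem ex_gen_self (w : V) : ex w (gen G w) = 1 := by simp [ex_gen]

theorem ex_gen_ne {w v : V} (h : v ≠ w) : ex w (gen G v) = 0 := by simp [ex_gen, h]

theorem ex_eq_zero_of_mem_sub {S : Set V} {w : V} (hw : w ∉ S) {g : RAAG G} (hg : g ∈ sub G S) :
    ex w g = 0 := by
  induction hg using sub_induction_right with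
  | one => simp
  | mul g _ v hv h => rw [ex_mul, h, ex_gen_ne (by rintro rfl; exact hw hv), add_zero]
  | inv g _ v hv h => rw [ex_mul, ex_inv, h, ex_gen_ne (by rintro rfl; exact hw hv)]; simp

open Classical in
/-- The retraction onto the subgroup generated by a set of vertices, killing all others. -/
def retr (G : SimpleGraph V) (S : Set V) : RAAG G →* RAAG G :=
  lift (fun v => if v ∈ S then gen G v else 1) (by
    intro u v h
    by_cases hu : u ∈ S <;> by_cases hv : v ∈ S <;> simp [hu, hv, gen_commute h])

theorem retr_gen_mem {S : Set V} {v : V} (h : v ∈ S) : retr G S (gen G v) = gen G v := by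
  simp [retr, h]

theorem retr_gen_notMem {S : Set V} {v : V} (h : v ∉ S) : retr G S (gen G v) = 1 := by
  simp [retr, h]

theorem retr_of_mem {S : Set V} {g : RAAG G} (hg : g ∈ sub G S) : retr G S g = g := by
  induction hg using sub_induction_right with
  | one => simp
  | mul g _ v hv h => rw [map_mul, h, retr_gen_mem hv]
  | inv g _ v hv h => rw [map_mul, map_inv, h, retr_gen_mem hv]

theorem retr_mem_sub_inter {S T : Set V} {g : RAAG G} (hg : g ∈ sub G T) :
    retr G S g ∈ sub G (S ∩ T) := by
  induction hg using sub_induction_right with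
  | one => simp [one_mem]
  | mul g _ v hv h =>
    rw [map_mul]
    refine mul_mem h ?_
    by_cases hS : v ∈ S
    · rw [retr_gen_mem hS]; exact gen_mem_sub ⟨hS, hv⟩
    · rw [retr_gen_notMem hS]; exact one_mem _
  | inv g _ v hv h =>
    rw [map_mul, map_inv]
    refine mul_mem h (inv_mem ?_)
    by_cases hS : v ∈ S
    · rw [retr_gen_mem hS]; exact gen_mem_sub ⟨hS, hv⟩
    · rw [retr_gen_notMem hS]; exact one_mem _

theorem retr_mem (S : Set V) (g : RAAG G) : retr G S g ∈ sub G S := by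
  have := retr_mem_sub_inter (S := S) (T := Set.univ) (g := g) (by rw [sub_univ]; trivial)
  simpa using this

theorem ex_retr {S : Set V} {w : V} (hw : w ∈ S) (g : RAAG G) : ex w (retr G S g) = ex w g := by
  have : (expHom G w).comp (retr G S) = expHom G w := by
    refine hom_ext fun v => ?_
    by_cases hS : v ∈ S
    · simp [retr_gen_mem hS]
    · have : v ≠ w := by rintro rfl; exact hS hw
      simp [retr_gen_notMem hS, expHom, this]
  exact congrArg Multiplicative.toAdd (DFunLike.congr_fun this g)

/-- If an element of `⟨S⟩` is conjugate into `⟨T⟩`, it is conjugate into `⟨S ∩ T⟩`. -/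
theorem conj_inter {S T : Set V} {x : RAAG G} (hS : ∃ g, g⁻¹ * x * g ∈ sub G S)
    (hT : ∃ g, g⁻¹ * x * g ∈ sub G T) : ∃ g, g⁻¹ * x * g ∈ sub G (S ∩ T) := by
  obtain ⟨g, hg⟩ := hS
  obtain ⟨h, hh⟩ := hT
  refine ⟨g * retr G S (g⁻¹ * h), ?_⟩
  have h1 := retr_mem_sub_inter (S := S) hh
  have h2 := retr_of_mem hg
  have : (g * retr G S (g⁻¹ * h))⁻¹ * x * (g * retr G S (g⁻¹ * h)) =
      retr G S (h⁻¹ * x * h) := by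
    calc _ = (retr G S (g⁻¹ * h))⁻¹ * (g⁻¹ * x * g) * retr G S (g⁻¹ * h) := by group
      _ = (retr G S (g⁻¹ * h))⁻¹ * retr G S (g⁻¹ * x * g) * retr G S (g⁻¹ * h) := by rw [h2]
      _ = retr G S ((g⁻¹ * h)⁻¹ * (g⁻¹ * x * g) * (g⁻¹ * h)) := by simp only [map_mul, map_inv]
      _ = _ := by congr 1; group
  rwa [this]

theorem mem_sub_singleton {v : V} {g : RAAG G} (h : g ∈ sub G {v}) : ∃ n : ℤ, g = gen G v ^ n := by
  rw [sub, Set.image_singleton, Subgroup.mem_closure_singleton] at h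
  obtain ⟨n, hn⟩ := h
  exact ⟨n, hn.symm⟩

end Basic

section Halfspaces

variable {V : Type} {G : SimpleGraph V}

/-- The subgroup generated by the link of a vertex. -/
abbrev lk (G : SimpleGraph V) (v : V) : Subgroup (RAAG G) := sub G (G.neighborSet v)

theorem mul_gen_mem_lk_iff {v w : V} (h : G.Adj v w) (g : RAAG G) :
    g * gen G w ∈ lk G v ↔ g ∈ lk G v :=
  Subgroup.mul_mem_cancel_right _ (gen_mem_sub h)

open Classical in
/-- Right multiplication by `w` on the double cover of the Cayley graph which is twisted along the
edges labelled `v` issuing from the subgroup generated by the link of `v`. -/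
def twist (G : SimpleGraph V) (v w : V) : Equiv.Perm (RAAG G × Bool) where
  toFun p := (p.1 * gen G w, if w = v ∧ p.1 ∈ lk G v then !p.2 else p.2)
  invFun p := (p.1 * (gen G w)⁻¹, if w = v ∧ p.1 * (gen G w)⁻¹ ∈ lk G v then !p.2 else p.2)
  left_inv p := by
    ext
    · simp
    · by_cases h : w = v ∧ p.1 ∈ lk G v <;> simp [h]
  right_inv p := by
    ext
    · simp
    · by_cases h : w = v ∧ p.1 * (gen G w)⁻¹ ∈ lk G v
      · obtain ⟨rfl, h⟩ := h
        simp [h]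
      · simp [h]

/-- The monodromy of the twisted double cover. -/
def monodromy (G : SimpleGraph V) (v : V) : RAAG G →* (Equiv.Perm (RAAG G × Bool))ᵐᵒᵖ :=
  lift (fun w => MulOpposite.op (twist G v w)) (by
    intro u w h
    refine MulOpposite.unop_injective (Equiv.ext fun p => ?_)
    have hc := gen_commute h
    simp only [MulOpposite.unop_mul, MulOpposite.unop_op, Equiv.Perm.mul_apply, twist,
      Equiv.coe_fn_mk, mul_assoc, hc.eq]
    refine Prod.ext rfl ?_
    have h1 : u = v → (p.1 * gen G w ∈ lk G v ↔ p.1 ∈ lk G v) := by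
      rintro rfl; exact mul_gen_mem_lk_iff h _
    have h2 : w = v → (p.1 * gen G u ∈ lk G v ↔ p.1 ∈ lk G v) := by
      rintro rfl; exact mul_gen_mem_lk_iff h.symm _
    have h3 : u = v → w ≠ v := by rintro rfl; exact h.ne'
    dsimp only
    split_ifs <;> first | rfl | (exfalso; tauto))

/-- The halfspace of the Cayley graph beyond the wall crossed by the edge from `1` to `v`. -/
def half (G : SimpleGraph V) (v : V) : Set (RAAG G) :=
  {g | ((monodromy G v g).unop (1, false)).2 = true}

theorem monodromy_mul_gen (v w : V) (g : RAAG G) (p : RAAG G × Bool) :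
    (monodromy G v (g * gen G w)).unop p = twist G v w ((monodromy G v g).unop p) := by
  rw [map_mul, MulOpposite.unop_mul, Equiv.Perm.mul_apply]
  rfl

theorem monodromy_fst (v : V) (g : RAAG G) :
    ((monodromy G v g).unop (1, false)).1 = g := by
  induction g using induction_right with
  | one => simp
  | mul g w h => rw [monodromy_mul_gen]; simp [twist, h]
  | inv g w h =>
    have := monodromy_mul_gen v w (g * (gen G w)⁻¹) (1, false)
    rw [inv_mul_cancel_right] at this
    rw [this] at h
    simp only [twist, Equiv.coe_fn_mk] at h
    exact eq_mul_inv_of_mul_eq h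

open Classical in
theorem monodromy_snd (v w : V) (g : RAAG G) :
    ((monodromy G v (g * gen G w)).unop (1, false)).2 =
      if w = v ∧ g ∈ lk G v then !((monodromy G v g).unop (1, false)).2
      else ((monodromy G v g).unop (1, false)).2 := by
  rw [monodromy_mul_gen]
  simp only [twist, Equiv.coe_fn_mk, monodromy_fst]

theorem one_notMem_half (v : V) : (1 : RAAG G) ∉ half G v := by simp [half]

theorem mul_gen_mem_half_of_ne {v w : V} (h : w ≠ v) (g : RAAG G) :
    g * gen G w ∈ half G v ↔ g ∈ half G v := by
  simp only [half, Set.mem_ofPred_eq, monodromy_snd]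
  simp [h]

theorem mul_gen_mem_half_of_notMem {v : V} {g : RAAG G} (h : g ∉ lk G v) (w : V) :
    g * gen G w ∈ half G v ↔ g ∈ half G v := by
  simp only [half, Set.mem_ofPred_eq, monodromy_snd]
  simp [h]

theorem mul_mem_half_of_mem_sub {v : V} {S : Set V} (hS : v ∉ S) {k : RAAG G} (hk : k ∈ sub G S)
    (g : RAAG G) : g * k ∈ half G v ↔ g ∈ half G v := by
  induction hk using sub_induction_right with
  | one => simp
  | mul k hk w hw h =>
    rw [← mul_assoc, mul_gen_mem_half_of_ne (by rintro rfl; exact hS hw), h]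
  | inv k hk w hw h =>
    rw [← h, ← mul_gen_mem_half_of_ne (w := w) (v := v) (by rintro rfl; exact hS hw), ← mul_assoc,
      inv_mul_cancel_right]

theorem notMem_half_of_mem_lk {v : V} {g : RAAG G} (h : g ∈ lk G v) : g ∉ half G v := by
  have := mul_mem_half_of_mem_sub (v := v) (by simp) h 1
  rw [one_mul] at this
  rw [this]
  exact one_notMem_half v

theorem mul_gen_mem_half_of_mem_lk {v : V} {g : RAAG G} (h : g ∈ lk G v) :
    g * gen G v ∈ half G v := by
  have := notMem_half_of_mem_lk h
  simp only [half, Set.mem_ofPred_eq, Bool.not_eq_true] at this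
  simp only [half, Set.mem_ofPred_eq, monodromy_snd]
  simp [h, this]

theorem gen_mem_half (v : V) : gen G v ∈ half G v := by
  simpa using mul_gen_mem_half_of_mem_lk (one_mem (lk G v))

theorem mem_lk_of_notMem_of_mem {v w : V} {g : RAAG G} (h : g ∉ half G v)
    (h' : g * gen G w ∈ half G v) : w = v ∧ g ∈ lk G v := by
  constructor
  · by_contra hne
    exact h ((mul_gen_mem_half_of_ne hne g).1 h')
  · by_contra hne
    exact h ((mul_gen_mem_half_of_notMem hne w).1 h')

theorem mul_gen_mem_half {v : V} {g : RAAG G} (h : g ∈ half G v) (w : V) :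
    g * gen G w ∈ half G v :=
  (mul_gen_mem_half_of_notMem (fun hl => notMem_half_of_mem_lk hl h) w).2 h

theorem mem_smul {g p : RAAG G} {a : Set (RAAG G)} : p ∈ g • a ↔ g⁻¹ * p ∈ a :=
  Set.mem_smul_set_iff_inv_smul_mem

theorem smul_half_of_mem_lk {v : V} {k : RAAG G} (hk : k ∈ lk G v) :
    k • half G v = half G v := by
  have key : ∀ k ∈ lk G v, ∀ g, k * g ∈ half G v ↔ g ∈ half G v := by
    intro k hk g
    have hstep : ∀ g w, (k * g ∈ half G v ↔ g ∈ half G v) ↔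
        (k * (g * gen G w) ∈ half G v ↔ g * gen G w ∈ half G v) := by
      intro g w
      rw [← mul_assoc]
      by_cases hw : w = v
      · subst hw
        by_cases hg : g ∈ lk G w
        · have hkg := mul_mem hk hg
          simp [notMem_half_of_mem_lk hg, notMem_half_of_mem_lk hkg,
            mul_gen_mem_half_of_mem_lk hg, mul_gen_mem_half_of_mem_lk hkg]
        · have hkg : k * g ∉ lk G w := by rwa [Subgroup.mul_mem_cancel_left _ hk]
          rw [mul_gen_mem_half_of_notMem hg, mul_gen_mem_half_of_notMem hkg]
      · rw [mul_gen_mem_half_of_ne hw, mul_gen_mem_half_of_ne hw]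
    induction g using induction_right with
    | one => simp [one_notMem_half, notMem_half_of_mem_lk hk]
    | mul g w h => exact (hstep g w).1 h
    | inv g w h =>
      have := hstep (g * (gen G w)⁻¹) w
      rw [inv_mul_cancel_right] at this
      exact this.2 h
  ext g
  rw [mem_smul]
  exact key _ (inv_mem hk) g

theorem mem_lk_of_smul_half {v : V} {k : RAAG G} (hk : k • half G v = half G v) : k ∈ lk G v := by
  have h1 : k ∉ half G v := by
    rw [← hk, mem_smul]; simp [one_notMem_half]
  have h2 : k * gen G v ∈ half G v := by
    rw [← hk, mem_smul]; simp [gen_mem_half]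
  exact (mem_lk_of_notMem_of_mem h1 h2).2

theorem smul_half_eq_iff {v : V} {g h : RAAG G} :
    g • half G v = h • half G v ↔ g⁻¹ * h ∈ lk G v := by
  constructor
  · intro e
    refine mem_lk_of_smul_half ?_
    rw [mul_smul, ← e, inv_smul_smul]
  · intro e
    have := smul_half_of_mem_lk e
    rw [mul_smul, inv_smul_eq_iff] at this
    exact this.symm

/-- `L` contains both endpoints of every edge of the Cayley graph with exactly one endpoint
in `a`. -/
def EdgeBdry (a L : Set (RAAG G)) : Prop :=
  ∀ g w, (g ∈ a ↔ g * gen G w ∈ a) ∨ (g ∈ L ∧ g * gen G w ∈ L)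

theorem EdgeBdry.compl {a L : Set (RAAG G)} (h : EdgeBdry a L) : EdgeBdry aᶜ L := by
  intro g w
  rcases h g w with h | h
  · left; simp [h]
  · right; exact h

theorem EdgeBdry.smul {a L : Set (RAAG G)} (h : EdgeBdry a L) (x : RAAG G) :
    EdgeBdry (x • a) (x • L) := by
  intro g w
  simp only [mem_smul, ← mul_assoc]
  exact h _ _

theorem EdgeBdry.mono {a L L' : Set (RAAG G)} (h : EdgeBdry a L) (hL : L ⊆ L') :
    EdgeBdry a L' := by
  intro g w
  exact (h g w).imp id (fun h => ⟨hL h.1, hL h.2⟩)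

theorem eq_empty_of_edge {a : Set (RAAG G)}
    (h : ∀ g w, g ∈ a ↔ g * gen G w ∈ a) {p : RAAG G} (hp : p ∉ a) : a = ∅ := by
  have key : ∀ g, g ∈ a ↔ (1 : RAAG G) ∈ a := by
    intro g
    induction g using induction_right with
    | one => rfl
    | mul g w hg => rw [← h, hg]
    | inv g w hg => rw [h _ w, inv_mul_cancel_right, hg]
  ext g
  simp only [Set.mem_empty_iff_false, iff_false]
  rwa [key, ← key p]

theorem disjoint_of_edgeBdry {a b La Lb : Set (RAAG G)} (ha : EdgeBdry a La)
    (hb : EdgeBdry b Lb) (h1 : Disjoint La b) (h2 : Disjoint Lb a) {p : RAAG G}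
    (hp : ¬(p ∈ a ∧ p ∈ b)) : Disjoint a b := by
  rw [Set.disjoint_left] at *
  have : a ∩ b = ∅ := by
    refine eq_empty_of_edge (fun g w => ?_) (p := p) hp
    simp only [Set.mem_inter_iff]
    rcases ha g w with h | h <;> rcases hb g w with h' | h'
    · rw [h, h']
    · have := h2 h'.1; have := h2 h'.2; tauto
    · have := h1 h.1; have := h1 h.2; tauto
    · have := h1 h.1; have := h1 h.2; tauto
  rw [Set.disjoint_iff_inter_eq_empty.symm, Set.disjoint_left] at this
  exact fun _ h => this h

/-- The endpoints of the edges crossing the wall of `half G v`. -/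
def carrier (G : SimpleGraph V) (v : V) : Set (RAAG G) :=
  {g | g ∈ lk G v ∨ g * (gen G v)⁻¹ ∈ lk G v}

theorem one_mem_carrier (v : V) : (1 : RAAG G) ∈ carrier G v := Or.inl (one_mem _)

theorem half_edgeBdry (v : V) : EdgeBdry (half G v) (carrier G v) := by
  intro g w
  by_cases hw : w = v
  · subst hw
    by_cases hg : g ∈ lk G w
    · right; exact ⟨Or.inl hg, Or.inr (by simpa using hg)⟩
    · left; rw [mul_gen_mem_half_of_notMem hg]
  · left; rw [mul_gen_mem_half_of_ne hw]

theorem carrier_side {v : V} {g k : RAAG G} (hg : g ∉ lk G v) (hk : k ∈ carrier G v) :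
    k ∈ g • half G v ↔ (1 : RAAG G) ∈ g • half G v := by
  have h1 : ∀ k ∈ lk G v, (k ∈ g • half G v ↔ (1 : RAAG G) ∈ g • half G v) := by
    intro k hk
    rw [mem_smul, mem_smul, mul_one, mul_mem_half_of_mem_sub (by simp) hk]
  rcases hk with hk | hk
  · exact h1 k hk
  · have h2 : g⁻¹ * (k * (gen G v)⁻¹) ∉ lk G v := by
      rw [Subgroup.mul_mem_cancel_right _ hk]
      exact fun h => hg (by simpa using inv_mem h)
    rw [← h1 _ hk, mem_smul, mem_smul, ← mul_gen_mem_half_of_notMem h2 v, mul_assoc,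
      inv_mul_cancel_right]

theorem smul_carrier_side {v : V} {g h k : RAAG G} (hg : h⁻¹ * g ∉ lk G v)
    (hk : k ∈ h • carrier G v) : k ∈ g • half G v ↔ h ∈ g • half G v := by
  have := carrier_side hg (mem_smul.1 hk)
  rw [mem_smul, mem_smul] at this
  rw [mem_smul, mem_smul]
  simpa [mul_assoc] using this

/-- Two distinct walls of the same type do not cross. -/
theorem nested {v : V} {g h : RAAG G} (hne : g⁻¹ * h ∉ lk G v) :
    (h ∉ g • half G v → g ∉ h • half G v → Disjoint (g • half G v) (h • half G v)) ∧
    (h ∈ g • half G v → g ∉ h • half G v → h • half G v ⊆ g • half G v) ∧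
    (h ∈ g • half G v → g ∈ h • half G v → g • half G v ∪ h • half G v = Set.univ) := by
  have hne' : h⁻¹ * g ∉ lk G v := fun H => hne (by simpa using inv_mem H)
  have bg := (half_edgeBdry v).smul g
  have bh := (half_edgeBdry v).smul h
  have mg : g ∈ g • carrier G v := by rw [mem_smul]; simp [one_mem_carrier]
  have ng : g ∉ g • half G v := by rw [mem_smul]; simp [one_notMem_half]
  have nh : h ∉ h • half G v := by rw [mem_smul]; simp [one_notMem_half]
  have mgv : g * gen G v ∈ g • half G v := by rw [mem_smul]; simp [gen_mem_half]
  have mgc : g * gen G v ∈ g • carrier G v := by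
    rw [mem_smul]; right; simp [one_mem]
  have mhv : h * gen G v ∈ h • half G v := by rw [mem_smul]; simp [gen_mem_half]
  have mhc : h * gen G v ∈ h • carrier G v := by
    rw [mem_smul]; right; simp [one_mem]
  have sg : ∀ k ∈ g • carrier G v, (k ∈ h • half G v ↔ g ∈ h • half G v) :=
    fun k hk => smul_carrier_side hne hk
  have sh : ∀ k ∈ h • carrier G v, (k ∈ g • half G v ↔ h ∈ g • half G v) :=
    fun k hk => smul_carrier_side hne' hk
  refine ⟨fun h1 h2 => ?_, fun h1 h2 => ?_, fun h1 h2 => ?_⟩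
  · refine disjoint_of_edgeBdry bg bh ?_ ?_ (p := g) (fun h => ng h.1)
    · exact Set.disjoint_left.2 fun k hk => by rwa [sg k hk]
    · exact Set.disjoint_left.2 fun k hk => by rwa [sh k hk]
  · rw [← Set.disjoint_compl_left_iff_subset]
    refine disjoint_of_edgeBdry bg.compl bh ?_ ?_ (p := h) (fun h => nh h.2)
    · exact Set.disjoint_left.2 fun k hk => by rwa [sg k hk]
    · exact Set.disjoint_left.2 fun k hk => by simpa [sh k hk] using h1
  · rw [← Set.compl_subset_iff_union, ← Set.disjoint_compl_right_iff_subset]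
    refine disjoint_of_edgeBdry bg.compl bh.compl ?_ ?_ (p := g * gen G v) (fun h => h.1 mgv)
    · exact Set.disjoint_left.2 fun k hk => by simpa [sg k hk] using h2
    · exact Set.disjoint_left.2 fun k hk => by simpa [sh k hk] using h1

theorem separating_finite (v : V) (p q : RAAG G) :
    {a : Set (RAAG G) | ∃ g : RAAG G, a = g • half G v ∧ ¬(p ∈ a ↔ q ∈ a)}.Finite := by
  have step : ∀ (q : RAAG G) (w : V) (g : RAAG G),
      ¬(q ∈ g • half G v ↔ q * gen G w ∈ g • half G v) → g • half G v = q • half G v := by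
    intro q w g h
    rw [smul_half_eq_iff]
    by_contra hne
    apply h
    rw [mem_smul, mem_smul, ← mul_assoc, mul_gen_mem_half_of_notMem hne]
  obtain ⟨r, rfl⟩ : ∃ r, q = p * r := ⟨p⁻¹ * q, by group⟩
  induction r using induction_right with
  | one => simp
  | mul r w h =>
    refine (h.insert ((p * r) • half G v)).subset ?_
    rintro a ⟨g, rfl, hg⟩
    by_cases hs : p * r ∈ g • half G v ↔ p * r * gen G w ∈ g • half G v
    · right
      exact ⟨g, rfl, by rwa [← mul_assoc, ← hs] at hg⟩
    · left; exact step _ _ _ hs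
  | inv r w h =>
    refine (h.insert ((p * r * (gen G w)⁻¹) • half G v)).subset ?_
    rintro a ⟨g, rfl, hg⟩
    have := step (p * r * (gen G w)⁻¹) w g
    rw [inv_mul_cancel_right] at this
    by_cases hs : p * r * (gen G w)⁻¹ ∈ g • half G v ↔ p * r ∈ g • half G v
    · right
      exact ⟨g, rfl, by rwa [← mul_assoc, hs] at hg⟩
    · left; exact this hs

end Halfspaces

section Dichotomy

variable {V : Type} {G : SimpleGraph V}

/-- The elements which are products with `n` letters `u` or `u⁻¹`, and other letters. -/
def level (G : SimpleGraph V) (u : V) : ℕ → Set (RAAG G)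
  | 0 => sub G {u}ᶜ
  | n + 1 => {g | ∃ s ∈ level G u n, ∃ b ∈ sub G {u}ᶜ,
      g = s * gen G u * b ∨ g = s * (gen G u)⁻¹ * b}

theorem level_mul_right {u : V} {n : ℕ} {g b : RAAG G} (hg : g ∈ level G u n)
    (hb : b ∈ sub G {u}ᶜ) : g * b ∈ level G u n := by
  cases n with
  | zero => exact Subgroup.mul_mem _ hg hb
  | succ n =>
    obtain ⟨s, hs, b', hb', h⟩ := hg
    refine ⟨s, hs, b' * b, mul_mem hb' hb, ?_⟩
    rcases h with rfl | rfl <;> simp [mul_assoc]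

theorem level_mul_left {u : V} {n : ℕ} {g b : RAAG G} (hg : g ∈ level G u n)
    (hb : b ∈ sub G {u}ᶜ) : b * g ∈ level G u n := by
  induction n generalizing g with
  | zero => exact Subgroup.mul_mem _ hb hg
  | succ n ih =>
    obtain ⟨s, hs, b', hb', h⟩ := hg
    refine ⟨b * s, ih hs, b', hb', ?_⟩
    rcases h with rfl | rfl <;> simp [mul_assoc]

theorem level_letter_mul {u : V} {n : ℕ} {g x : RAAG G} (hg : g ∈ level G u n)
    (hx : x = gen G u ∨ x = (gen G u)⁻¹) : x * g ∈ level G u (n + 1) := by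
  induction n generalizing g with
  | zero =>
    refine ⟨1, one_mem (sub G {u}ᶜ), g, hg, ?_⟩
    rcases hx with rfl | rfl <;> simp
  | succ n ih =>
    obtain ⟨s, hs, b', hb', h⟩ := hg
    refine ⟨x * s, ih hs, b', hb', ?_⟩
    rcases h with rfl | rfl <;> simp [mul_assoc]

theorem level_inv {u : V} {n : ℕ} {g : RAAG G} (hg : g ∈ level G u n) :
    g⁻¹ ∈ level G u n := by
  induction n generalizing g with
  | zero => exact Subgroup.inv_mem _ hg
  | succ n ih =>
    obtain ⟨s, hs, b, hb, h⟩ := hg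
    rcases h with rfl | rfl
    · rw [mul_inv_rev, mul_inv_rev]
      exact level_mul_left (level_letter_mul (ih hs) (Or.inr rfl)) (inv_mem hb)
    · rw [mul_inv_rev, mul_inv_rev, inv_inv]
      exact level_mul_left (level_letter_mul (ih hs) (Or.inl rfl)) (inv_mem hb)

theorem exists_level (u : V) (g : RAAG G) : ∃ n, g ∈ level G u n := by
  induction g using induction_right with
  | one => exact ⟨0, one_mem (sub G {u}ᶜ)⟩
  | mul g v h =>
    obtain ⟨n, hn⟩ := h
    by_cases hv : v = u
    · exact ⟨n + 1, g, hn, 1, one_mem _, Or.inl (by rw [hv, mul_one])⟩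
    · exact ⟨n, level_mul_right hn (gen_mem_sub hv)⟩
  | inv g v h =>
    obtain ⟨n, hn⟩ := h
    by_cases hv : v = u
    · exact ⟨n + 1, g, hn, 1, one_mem _, Or.inr (by rw [hv, mul_one])⟩
    · exact ⟨n, level_mul_right hn (inv_mem (gen_mem_sub hv))⟩

theorem lk_le (u : V) : lk G u ≤ sub G {u}ᶜ :=
  sub_mono fun w hw => by
    have : G.Adj u w := hw
    exact this.ne'

theorem mul_mem_half_of_mem_compl {u : V} {b : RAAG G} (hb : b ∈ sub G {u}ᶜ) (g : RAAG G) :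
    g * b ∈ half G u ↔ g ∈ half G u :=
  mul_mem_half_of_mem_sub (by simp) hb g

theorem mul_gen_inv_mem_half_imp {u : V} {g : RAAG G} (w : V) (h : g * (gen G w)⁻¹ ∈ half G u) :
    g ∈ half G u := by
  simpa using mul_gen_mem_half h w

theorem level_of_mem_half {u : V} {n : ℕ} {g : RAAG G} (hg : g ∈ level G u n)
    (hH : g ∈ half G u) :
    ∃ j < n, ∃ k ∈ lk G u, ∃ s ∈ level G u j, g = k * gen G u * s := by
  induction n generalizing g with
  | zero =>
    have := (mul_mem_half_of_mem_compl hg 1).1 (by simpa using hH)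
    exact absurd this (one_notMem_half u)
  | succ n ih =>
    obtain ⟨s, hs, b, hb, h⟩ := hg
    by_cases hsH : s ∈ half G u
    · obtain ⟨j, hj, k, hk, s', hs', rfl⟩ := ih hs hsH
      rcases h with rfl | rfl
      · exact ⟨j + 1, by omega, k, hk, s' * gen G u * b, ⟨s', hs', b, hb, Or.inl rfl⟩, by
          simp [mul_assoc]⟩
      · exact ⟨j + 1, by omega, k, hk, s' * (gen G u)⁻¹ * b, ⟨s', hs', b, hb, Or.inr rfl⟩, by
          simp [mul_assoc]⟩
    · rcases h with rfl | rfl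
      · rw [mul_mem_half_of_mem_compl hb] at hH
        exact ⟨0, by omega, s, (mem_lk_of_notMem_of_mem hsH hH).2, b, hb, rfl⟩
      · rw [mul_mem_half_of_mem_compl hb] at hH
        exact absurd (mul_gen_inv_mem_half_imp u hH) hsH

theorem level_of_gen_mul_notMem_half {u : V} {n : ℕ} {g : RAAG G} (hg : g ∈ level G u n)
    (hH : gen G u * g ∉ half G u) :
    ∃ j < n, ∃ k ∈ lk G u, ∃ s ∈ level G u j, gen G u * g = k * s := by
  induction n generalizing g with
  | zero =>
    exact absurd ((mul_mem_half_of_mem_compl hg _).2 (gen_mem_half u)) hH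
  | succ n ih =>
    obtain ⟨s, hs, b, hb, h⟩ := hg
    by_cases hsH : gen G u * s ∈ half G u
    · rcases h with rfl | rfl
      · rw [← mul_assoc, mul_mem_half_of_mem_compl hb, ← mul_assoc] at hH
        exact absurd (mul_gen_mem_half hsH u) hH
      · rw [← mul_assoc, mul_mem_half_of_mem_compl hb, ← mul_assoc] at hH
        have := (mem_lk_of_notMem_of_mem hH (w := u) (by simpa using hsH)).2
        exact ⟨0, by omega, _, this, b, hb, by simp [mul_assoc]⟩
    · obtain ⟨j, hj, k, hk, s', hs', h'⟩ := ih hs hsH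
      rcases h with rfl | rfl
      · exact ⟨j + 1, by omega, k, hk, s' * gen G u * b, ⟨s', hs', b, hb, Or.inl rfl⟩, by
          rw [← mul_assoc, ← mul_assoc, h']; simp [mul_assoc]⟩
      · exact ⟨j + 1, by omega, k, hk, s' * (gen G u)⁻¹ * b, ⟨s', hs', b, hb, Or.inr rfl⟩, by
          rw [← mul_assoc, ← mul_assoc, h']; simp [mul_assoc]⟩

theorem smul_half_ssubset {u : V} {z : RAAG G} (h1 : z ∈ half G u) (h2 : z⁻¹ ∉ half G u) :
    z • half G u ⊂ half G u := by
  have hz : z ∉ lk G u := fun h => notMem_half_of_mem_lk h h1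
  have h := (nested (v := u) (g := 1) (h := z) (by simpa using hz)).2.1 (by simpa using h1)
    (by rw [mem_smul]; simpa using h2)
  rw [one_smul] at h
  exact LE.le.ssubset_of_ne h fun e => hz (mem_lk_of_smul_half e)

/-- Every element is either conjugate into the subgroup avoiding `u`, or it or its inverse
is conjugate to an element pushing the halfspace of `u` strictly into itself. -/
theorem dichotomy (u : V) (x : RAAG G) :
    (∃ h, h⁻¹ * x * h ∈ sub G {u}ᶜ) ∨
      ∃ h z, (z = h⁻¹ * x * h ∨ z = h⁻¹ * x⁻¹ * h) ∧ z • half G u ⊂ half G u := by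
  classical
  have hex : ∃ n, ∃ h, h⁻¹ * x * h ∈ level G u n := by
    obtain ⟨n, hn⟩ := exists_level u x
    exact ⟨n, 1, by simpa using hn⟩
  have hmin := fun m => Nat.find_min hex (m := m)
  obtain ⟨h, hh⟩ := Nat.find_spec hex
  generalize Nat.find hex = n at hmin hh
  cases n with
  | zero => exact Or.inl ⟨h, hh⟩
  | succ n =>
    right
    have hmin' : ∀ j < n + 1, ∀ h z, (z = h⁻¹ * x * h ∨ z = h⁻¹ * x⁻¹ * h) →
        z ∉ level G u j := by
      rintro j hj h z (rfl | rfl) hz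
      · exact hmin j hj ⟨h, hz⟩
      · refine hmin j hj ⟨h, ?_⟩
        have := level_inv hz
        convert this using 1
        group
    obtain ⟨h, g, hg, hz⟩ : ∃ h, ∃ g ∈ level G u n,
        (gen G u * g = h⁻¹ * x * h ∨ gen G u * g = h⁻¹ * x⁻¹ * h) := by
      obtain ⟨s, hs, b, hb, e⟩ := hh
      rcases e with e | e
      · refine ⟨h * s, b * s, level_mul_left hs hb, Or.inl ?_⟩
        calc _ = s⁻¹ * (s * gen G u * b) * s := by group
          _ = s⁻¹ * (h⁻¹ * x * h) * s := by rw [e]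
          _ = _ := by group
      · refine ⟨h * b⁻¹, s⁻¹ * b⁻¹, level_mul_right (level_inv hs) (inv_mem hb), Or.inr ?_⟩
        calc _ = b * (s * (gen G u)⁻¹ * b)⁻¹ * b⁻¹ := by group
          _ = b * (h⁻¹ * x * h)⁻¹ * b⁻¹ := by rw [e]
          _ = _ := by group
    refine ⟨h, _, hz, smul_half_ssubset ?_ ?_⟩
    · by_contra hH
      obtain ⟨j, hj, k, hk, s, hs, e⟩ := level_of_gen_mul_notMem_half hg hH
      refine hmin' j (by omega) h _ hz ?_
      rw [e]
      exact level_mul_left hs (lk_le u hk)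
    · intro hH
      rw [mul_inv_rev] at hH
      obtain ⟨j, hj, k, hk, s, hs, e⟩ :=
        level_of_mem_half (level_inv hg) (mul_gen_inv_mem_half_imp u hH)
      have hc := (commute_of_mem_sub_lk hk).inv_left
      have e' : g = s⁻¹ * (gen G u)⁻¹ * k⁻¹ := by
        rw [← inv_inv g, e]; group
      refine hmin' j (by omega) (h * gen G u) (s⁻¹ * k⁻¹) ?_
        (level_mul_right (level_inv hs) (lk_le u (inv_mem hk)))
      have e2 : s⁻¹ * k⁻¹ = (gen G u)⁻¹ * (gen G u * g) * gen G u := by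
        rw [e']
        calc s⁻¹ * k⁻¹ = s⁻¹ * (gen G u)⁻¹ * (gen G u * k⁻¹) := by group
          _ = s⁻¹ * (gen G u)⁻¹ * (k⁻¹ * gen G u) := by rw [hc.eq]
          _ = _ := by group
      rw [e2]
      rcases hz with hz | hz
      · left; rw [hz]; group
      · right; rw [hz]; group

theorem zpow_smul_antitone {a : Set (RAAG G)} {y : RAAG G} (hy : y • a ⊆ a) {m n : ℤ}
    (h : m ≤ n) : y ^ n • a ⊆ y ^ m • a := by
  obtain ⟨k, rfl⟩ := Int.le.dest h
  induction k with
  | zero => simp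
  | succ k ih =>
    refine subset_trans ?_ (ih (by omega))
    have : y ^ (m + (k + 1 : ℕ)) = y ^ (m + k) * y := by
      rw [← zpow_add_one]; congr 1; push_cast; ring
    rw [this, mul_smul]
    exact Set.smul_set_mono hy

theorem zpow_smul_injective {a : Set (RAAG G)} {y : RAAG G} (hy : y • a ⊂ a) {m n : ℤ}
    (h : y ^ m • a = y ^ n • a) : m = n := by
  have key : ∀ m n : ℤ, m < n → y ^ m • a ≠ y ^ n • a := by
    intro m n hmn e
    have h1 : y ^ m • a ⊆ y ^ (m + 1) • a := by
      rw [e]; exact zpow_smul_antitone hy.1 (by omega)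
    rw [zpow_add_one, mul_smul, Set.smul_set_subset_smul_set_iff] at h1
    exact hy.2 h1
  rcases lt_trichotomy m n with h' | h' | h'
  · exact absurd h (key _ _ h')
  · exact h'
  · exact absurd h.symm (key _ _ h')

theorem exists_separating {u : V} {h y : RAAG G} (hy : y • h • half G u ⊂ h • half G u)
    {s : ℤ} (hs : s ≠ 0) (p q : RAAG G) :
    ∃ N : ℕ, (p ∈ y ^ (s * N) • h • half G u ↔ q ∈ y ^ (s * N) • h • half G u) := by
  by_contra! hcon
  refine Set.infinite_of_injective_forall_mem (f := fun N : ℕ => y ^ (s * N) • h • half G u) ?_ ?_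
    (separating_finite u p q)
  · intro m n e
    have := zpow_smul_injective hy e
    have := mul_left_cancel₀ hs this
    exact_mod_cast this
  · intro N
    refine ⟨y ^ (s * N) * h, by simp only [mul_smul], ?_⟩
    have := hcon N
    tauto

theorem exists_notMem {u : V} {h y : RAAG G} (hy : y • h • half G u ⊂ h • half G u)
    (p : RAAG G) : ∃ N : ℤ, p ∉ y ^ N • h • half G u := by
  obtain ⟨N, hN⟩ := exists_separating hy (s := 1) one_ne_zero h p
  refine ⟨1 * N, fun hp => ?_⟩
  have h1 := hN.2 hp
  have h2 := zpow_smul_antitone hy.1 (m := 0) (n := 1 * N) (by omega) h1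
  simp [mem_smul, one_notMem_half] at h2

theorem exists_mem {u : V} {h y : RAAG G} (hy : y • h • half G u ⊂ h • half G u)
    (p : RAAG G) : ∃ N : ℤ, p ∈ y ^ N • h • half G u := by
  obtain ⟨N, hN⟩ := exists_separating hy (s := -1) (by norm_num) (h * gen G u) p
  refine ⟨_, hN.1 ?_⟩
  refine zpow_smul_antitone hy.1 (m := -1 * N) (n := 0) (by omega) ?_
  simp [mem_smul, gen_mem_half]

theorem exists_gap_of_anti {P : ℤ → Prop} (hanti : ∀ m n, m ≤ n → P n → P m) (h1 : ∃ n, P n)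
    (h2 : ∃ n, ¬P n) : ∃ n, P n ∧ ¬P (n + 1) := by
  obtain ⟨b, hb⟩ := h2
  obtain ⟨n, hn, hmax⟩ := Int.exists_greatest_of_bdd (P := P)
    ⟨b, fun z hz => by by_contra! hlt; exact hb (hanti _ _ hlt.le hz)⟩ h1
  exact ⟨n, hn, fun h => by have := hmax _ h; omega⟩

theorem exists_gap {u : V} {h y : RAAG G} (hy : y • h • half G u ⊂ h • half G u)
    (p : RAAG G) : ∃ n : ℤ, p ∈ y ^ n • h • half G u ∧ p ∉ y ^ (n + 1) • h • half G u :=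
  exists_gap_of_anti (P := fun n => p ∈ y ^ n • h • half G u)
    (fun _ _ hmn h' => zpow_smul_antitone hy.1 hmn h') (exists_mem hy p) (exists_notMem hy p)

theorem comparable_of_commute {u : V} {y z : RAAG G} (hy : y • half G u ⊂ half G u)
    (hc : Commute y z) (N : ℤ) :
    z • half G u ⊆ y ^ N • half G u ∨ y ^ N • half G u ⊆ z • half G u := by
  by_cases he : (y ^ N)⁻¹ * z ∈ lk G u
  · left; rw [(smul_half_eq_iff (g := y ^ N) (h := z)).2 he]
  have he' : z⁻¹ * y ^ N ∉ lk G u := fun h => he (by simpa using inv_mem h)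
  have hy1 : y • (1 : RAAG G) • half G u ⊂ (1 : RAAG G) • half G u := by simpa using hy
  have hcM : ∀ M : ℤ, y ^ M • z • half G u = z • y ^ M • half G u := by
    intro M
    rw [← mul_smul, ← mul_smul, (hc.zpow_left M).eq]
  by_cases h1 : z ∈ y ^ N • half G u <;> by_cases h2 : y ^ N ∈ z • half G u
  · exfalso
    have h := (nested he).2.2 h1 h2
    obtain ⟨M, hM⟩ := exists_notMem hy1 1
    obtain ⟨M', hM'⟩ := exists_notMem hy1 z⁻¹
    rw [one_smul] at hM hM'
    have : (y ^ (max M' (M - N)))⁻¹ ∈ y ^ N • half G u ∪ z • half G u := by rw [h]; trivial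
    rcases this with h3 | h3
    · have h4 : (1 : RAAG G) ∈ y ^ (max M' (M - N) + N) • half G u := by
        rw [zpow_add, mul_smul, mem_smul, mul_one]; exact h3
      exact hM (zpow_smul_antitone hy.1 (by omega) h4)
    · have h4 : (1 : RAAG G) ∈ y ^ (max M' (M - N)) • z • half G u := by
        rw [mem_smul, mul_one]; exact h3
      rw [hcM, mem_smul, mul_one] at h4
      exact hM' (zpow_smul_antitone hy.1 (by omega) h4)
  · left; exact (nested he).2.1 h1 h2
  · right; exact (nested he').2.1 h2 h1
  · exfalso
    have h := (nested he).1 h1 h2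
    obtain ⟨M, hM⟩ := exists_mem hy1 1
    obtain ⟨M', hM'⟩ := exists_mem hy1 z⁻¹
    rw [one_smul] at hM hM'
    refine Set.disjoint_left.1 h (?_ : (y ^ (min M' (M - N)))⁻¹ ∈ _) ?_
    · have h4 : (1 : RAAG G) ∈ y ^ (min M' (M - N) + N) • half G u :=
        zpow_smul_antitone hy.1 (by omega) hM
      rwa [zpow_add, mul_smul, mem_smul, mul_one] at h4
    · have h4 : z⁻¹ ∈ y ^ (min M' (M - N)) • half G u :=
        zpow_smul_antitone hy.1 (by omega) hM'
      have h5 : (1 : RAAG G) ∈ y ^ (min M' (M - N)) • z • half G u := by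
        rw [hcM, mem_smul, mul_one]; exact h4
      rwa [mem_smul, mul_one] at h5

theorem exists_between_of_commute {u : V} {y z : RAAG G} (hy : y • half G u ⊂ half G u)
    (hc : Commute y z) :
    ∃ n : ℤ, z • half G u ⊆ y ^ n • half G u ∧ y ^ (n + 1) • half G u ⊂ z • half G u := by
  have hy1 : y • (1 : RAAG G) • half G u ⊂ (1 : RAAG G) • half G u := by simpa using hy
  obtain ⟨n, h1, h2⟩ := exists_gap_of_anti (P := fun n => z • half G u ⊆ y ^ n • half G u)
    (fun m n hmn h => h.trans (zpow_smul_antitone hy.1 hmn)) (by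
      obtain ⟨M, hM⟩ := exists_mem hy1 z
      rw [one_smul] at hM
      refine ⟨M, (comparable_of_commute hy hc M).resolve_right fun h => ?_⟩
      have := h hM
      simp [mem_smul, one_notMem_half] at this) (by
      obtain ⟨M, hM⟩ := exists_notMem hy1 (z * gen G u)
      rw [one_smul] at hM
      refine ⟨M, fun h => hM (h ?_)⟩
      simp [mem_smul, gen_mem_half])
  exact ⟨n, h1, ((comparable_of_commute hy hc (n + 1)).resolve_left h2), h2⟩

/-- An element commuting with an element which is hyperbolic with respect to `u` has a
nontrivial power which agrees with a power of that element modulo the link of `u`. -/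
theorem exists_pow_mem_lk {u : V} {y z : RAAG G} (hy : y • half G u ⊂ half G u)
    (hc : Commute y z) : ∃ (n : ℤ) (a : ℤ), a ≠ 0 ∧ y ^ n * z ^ a ∈ lk G u := by
  choose n hn1 hn2 using fun a : ℕ => exists_between_of_commute hy (hc.pow_right a)
  have hfin := separating_finite u (1 : RAAG G) (y * gen G u)
  have hmem : ∀ a : ℕ, (y ^ (-n a) * z ^ a) • half G u ∈
      {a : Set (RAAG G) | ∃ g : RAAG G, a = g • half G u ∧ ¬(1 ∈ a ↔ y * gen G u ∈ a)} := by
    intro a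
    refine ⟨_, rfl, ?_⟩
    have h1 : (y ^ (-n a) * z ^ a) • half G u ⊆ half G u := by
      have := Set.smul_set_mono (a := y ^ (-n a)) (hn1 a)
      rwa [← mul_smul, ← mul_smul, ← zpow_add, neg_add_cancel, zpow_zero, one_smul] at this
    have h2 : y • half G u ⊆ (y ^ (-n a) * z ^ a) • half G u := by
      have := Set.smul_set_mono (a := y ^ (-n a)) (hn2 a).1
      rwa [← mul_smul, ← mul_smul, ← zpow_add, neg_add_cancel_left, zpow_one] at this
    have h3 := h2 (show y * gen G u ∈ _ by simp [mem_smul, gen_mem_half])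
    have h4 : (1 : RAAG G) ∉ _ := fun h => one_notMem_half u (h1 h)
    tauto
  obtain ⟨a, b, hab, e⟩ : ∃ a b : ℕ, a ≠ b ∧ (y ^ (-n a) * z ^ a) • half G u =
      (y ^ (-n b) * z ^ b) • half G u := by
    by_contra! hcon
    refine Set.infinite_of_injective_forall_mem
      (f := fun a : ℕ => (y ^ (-n a) * z ^ a) • half G u) ?_ hmem hfin
    intro a b e
    by_contra hne
    exact hcon a b hne e
  rw [smul_half_eq_iff] at e
  refine ⟨n a - n b, b - a, by omega, ?_⟩
  convert e using 1
  have hcz := (hc.zpow_left (n a - n b)).zpow_right (-(a : ℤ))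
  calc y ^ (n a - n b) * z ^ ((b : ℤ) - a) = y ^ (n a - n b) * z ^ (-(a : ℤ)) * z ^ b := by
        rw [mul_assoc, ← zpow_natCast z b, ← zpow_add]; congr 2; ring
    _ = z ^ (-(a : ℤ)) * y ^ (n a - n b) * z ^ b := by rw [hcz.eq]
    _ = _ := by
      rw [mul_inv_rev, ← zpow_neg, neg_neg, sub_eq_add_neg, zpow_add, ← zpow_natCast z a, ← zpow_neg]
      simp [mul_assoc]

theorem gen_smul_half_ssubset (v : V) : gen G v • half G v ⊂ half G v :=
  smul_half_ssubset (gen_mem_half v) fun h =>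
    one_notMem_half v (by simpa using mul_gen_mem_half h v)

theorem lk_le_star (v : V) : lk G v ≤ sub G (star G v) := sub_mono (Set.subset_insert _ _)

theorem gen_mem_sub_star (v : V) : gen G v ∈ sub G (star G v) :=
  gen_mem_sub (Set.mem_insert _ _)

theorem commute_gen_of_mem_sub_star {v : V} {z : RAAG G} (hz : z ∈ sub G (star G v)) :
    Commute (gen G v) z := by
  have key : ∀ w ∈ star G v, Commute (gen G v) (gen G w) := by
    rintro w (rfl | hw)
    · exact Commute.refl _
    · exact gen_commute hw
  induction hz using sub_induction_right with
  | one => exact Commute.one_right _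
  | mul g _ w hw h => exact h.mul_right (key w hw)
  | inv g _ w hw h => exact h.mul_right (key w hw).inv_right

/-- The centralizer of a generator is generated by its star. -/
theorem commute_gen_iff {v : V} {z : RAAG G} :
    Commute (gen G v) z ↔ z ∈ sub G (star G v) := by
  refine ⟨fun hc => ?_, commute_gen_of_mem_sub_star⟩
  obtain ⟨n, h1, h2⟩ := exists_between_of_commute (gen_smul_half_ssubset v) hc
  set W := (gen G v ^ (-n) * z) • half G v with hW
  have h1' : W ⊆ half G v := by
    have := Set.smul_set_mono (a := gen G v ^ (-n)) h1
    rwa [← mul_smul, ← mul_smul, ← zpow_add, neg_add_cancel, zpow_zero, one_smul] at this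
  have h2' : gen G v • half G v ⊂ W := by
    rw [hW, mul_smul, ssubset_iff_subset_not_subset]
    rw [show (gen G v) = gen G v ^ (-n) * gen G v ^ (n + 1) by
      rw [← zpow_add, neg_add_cancel_left, zpow_one]]
    rw [mul_smul]
    simp only [← zpow_add, neg_add_cancel_left, zpow_one]
    rw [Set.smul_set_subset_smul_set_iff, Set.smul_set_subset_smul_set_iff]
    exact h2
  have hW1 : (1 : RAAG G) ∉ W := fun h => one_notMem_half v (h1' h)
  have hW2 : gen G v * gen G v ∈ W := h2'.1 (by simp [mem_smul, gen_mem_half])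
  have hmem : (gen G v ^ (-n) * z)⁻¹ ∈ lk G v := by
    rw [hW, mem_smul, mul_one] at hW1
    rw [hW, mem_smul, ← mul_assoc] at hW2
    by_cases h3 : (gen G v ^ (-n) * z)⁻¹ * gen G v ∈ half G v
    · exact (mem_lk_of_notMem_of_mem hW1 h3).2
    · have := (mem_lk_of_notMem_of_mem h3 hW2).2
      rw [← smul_half_eq_iff, ← hW] at this
      exact absurd this.symm h2'.ne
  have : z = gen G v ^ n * (gen G v ^ (-n) * z) := by
    rw [← mul_assoc, ← zpow_add, add_neg_cancel, zpow_zero, one_mul]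
  rw [this]
  exact mul_mem (zpow_mem (gen_mem_sub_star v) _) (lk_le_star v (by simpa using inv_mem hmem))

end Dichotomy

section PingPong

/-- Alternating products of nontrivial powers of `c` and of `z`; the flag is `true` if the first
factor may be a power of `z`, and `false` if it may be a power of `c`. -/
inductive Alternating {A : Type*} [Group A] (c z : A) : Bool → A → Prop
  | one (b : Bool) : Alternating c z b 1
  | left (a : ℤ) (ha : a ≠ 0) (g : A) (hg : Alternating c z true g) :
      Alternating c z false (c ^ a * g)
  | right (a : ℤ) (ha : a ≠ 0) (g : A) (hg : Alternating c z false g) :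
      Alternating c z true (z ^ a * g)

theorem Alternating.zpow_left_mul {A : Type*} [Group A] {c z : A} {b : Bool} {g : A}
    (h : Alternating c z b g) (e : ℤ) : ∃ b, Alternating c z b (c ^ e * g) := by
  by_cases he : e = 0
  · subst he; exact ⟨b, by simpa using h⟩
  cases h with
  | one => exact ⟨false, .left e he 1 (.one _)⟩
  | right a ha g hg => exact ⟨false, .left e he _ (.right a ha g hg)⟩
  | left a ha g hg =>
    rw [← mul_assoc, ← zpow_add]
    by_cases hea : e + a = 0
    · rw [hea]; exact ⟨true, by simpa using hg⟩
    · exact ⟨false, .left _ hea g hg⟩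

theorem Alternating.zpow_right_mul {A : Type*} [Group A] {c z : A} {b : Bool} {g : A}
    (h : Alternating c z b g) (e : ℤ) : ∃ b, Alternating c z b (z ^ e * g) := by
  by_cases he : e = 0
  · subst he; exact ⟨b, by simpa using h⟩
  cases h with
  | one => exact ⟨true, .right e he 1 (.one _)⟩
  | left a ha g hg => exact ⟨true, .right e he _ (.left a ha g hg)⟩
  | right a ha g hg =>
    rw [← mul_assoc, ← zpow_add]
    by_cases hea : e + a = 0
    · rw [hea]; exact ⟨false, by simpa using hg⟩
    · exact ⟨true, .right _ hea g hg⟩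

theorem exists_alternating {A : Type*} [Group A] {c z g : A}
    (hg : g ∈ Subgroup.closure {c, z}) : ∃ b, Alternating c z b g := by
  induction hg using Subgroup.closure_induction_left with
  | one => exact ⟨true, .one _⟩
  | mul_left x hx y _ h =>
    obtain ⟨b, hb⟩ := h
    rcases hx with rfl | rfl
    · simpa using hb.zpow_left_mul 1
    · simpa using hb.zpow_right_mul 1
  | inv_mul_cancel x hx y _ h =>
    obtain ⟨b, hb⟩ := h
    rcases hx with rfl | rfl
    · simpa using hb.zpow_left_mul (-1)
    · simpa using hb.zpow_right_mul (-1)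

theorem mem_of_pingPong {A : Type*} [Group A] {c z : A} {P R : Set A} (hRP : R ⊆ P)
    (hc : ∀ a : ℤ, c ^ a ∉ P) (hcP : ∀ a : ℤ, a ≠ 0 → ∀ g ∈ P, c ^ a * g ∉ P)
    (hz : ∀ a : ℤ, a ≠ 0 → ∀ g ∉ P, z ^ a * g ∈ R) {g : A}
    (hg : g ∈ Subgroup.closure {c, z}) (hgP : g ∈ P) : g ∈ R := by
  have key : ∀ b g, Alternating c z b g → (b = true → g = 1 ∨ g ∈ R) ∧ (b = false → g ∉ P) := by
    intro b g h
    induction h with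
    | one b => exact ⟨fun _ => Or.inl rfl, fun _ => by simpa using hc 0⟩
    | left a ha g _ ih =>
      refine ⟨by simp, fun _ => ?_⟩
      rcases ih.1 rfl with rfl | h
      · simpa using hc a
      · exact hcP a ha g (hRP h)
    | right a ha g _ ih => exact ⟨fun _ => Or.inr (hz a ha g (ih.2 rfl)), by simp⟩
  obtain ⟨b, hb⟩ := exists_alternating hg
  cases b with
  | true =>
    rcases (key _ _ hb).1 rfl with rfl | h
    · exact absurd (by simpa using hgP) (hc 0)
    · exact h
  | false => exact absurd hgP ((key _ _ hb).2 rfl)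

end PingPong

section RankTwo

variable {V : Type} {G : SimpleGraph V}

/-- The union of the two halfspaces issuing from `1` across the edges labelled `v`. -/
def sides (G : SimpleGraph V) (v : V) : Set (RAAG G) := half G v ∪ ((gen G v)⁻¹ • half G v)ᶜ

theorem mem_sides {v : V} {g : RAAG G} :
    g ∈ sides G v ↔ g ∈ half G v ∨ gen G v * g ∉ half G v := by
  simp [sides, mem_smul]

theorem lk_inf_sub_pair {c v : V} (hadj : ¬G.Adj v c) {g : RAAG G} (h1 : g ∈ lk G v)
    (h2 : g ∈ sub G {c, v}) : g = 1 := by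
  have := retr_mem_sub_inter (S := {c, v}) h1
  rw [retr_of_mem h2] at this
  have he : ({c, v} : Set V) ∩ G.neighborSet v = ∅ := by
    ext w
    simp only [Set.mem_inter_iff, Set.mem_insert_iff, Set.mem_singleton_iff,
      SimpleGraph.mem_neighborSet, Set.mem_empty_iff_false, iff_false, not_and]
    rintro (rfl | rfl)
    · exact hadj
    · simp
  rw [he] at this
  simpa [sub] using this

theorem zpow_notMem_sides {c v : V} (hne : c ≠ v) (a : ℤ) : gen G c ^ a ∉ sides G v := by
  have hb : gen G c ^ a ∈ sub G {v}ᶜ := zpow_mem (gen_mem_sub hne) _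
  rw [mem_sides]
  have h1 := mul_mem_half_of_mem_compl hb 1
  rw [one_mul] at h1
  rw [h1, mul_mem_half_of_mem_compl hb]
  simp [one_notMem_half, gen_mem_half]

theorem zpow_notMem_lk {c v : V} (hadj : ¬G.Adj v c) {a : ℤ} (ha : a ≠ 0) {g : RAAG G}
    (hg : ex c g = a) : g ∉ lk G v := by
  intro h
  have := ex_eq_zero_of_mem_sub (w := c) (by simpa using hadj) h
  omega

theorem zpow_mul_notMem_sides {c v : V} (hne : c ≠ v) (hadj : ¬G.Adj v c) {a : ℤ} (ha : a ≠ 0)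
    {g : RAAG G} (hg : g ∈ sides G v) : gen G c ^ a * g ∉ sides G v := by
  have hb : ∀ a : ℤ, gen G c ^ a ∈ sub G {v}ᶜ := fun a => zpow_mem (gen_mem_sub hne) _
  have hbH : ∀ a : ℤ, gen G c ^ a ∉ half G v := fun a => by
    have h1 := mul_mem_half_of_mem_compl (hb a) 1
    rw [one_mul] at h1
    rw [h1]; exact one_notMem_half v
  have hvb : ∀ a : ℤ, gen G v * gen G c ^ a ∈ half G v := fun a => by
    rw [mul_mem_half_of_mem_compl (hb a)]; exact gen_mem_half v
  have hbv : ∀ a : ℤ, gen G c ^ a * (gen G v)⁻¹ ∉ half G v := fun a h =>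
    hbH a (mul_gen_inv_mem_half_imp v h)
  have hvbv : ∀ a : ℤ, a ≠ 0 → gen G v * gen G c ^ a * (gen G v)⁻¹ ∈ half G v := fun a ha => by
    by_contra h
    refine zpow_notMem_lk hadj ha ?_ (mem_lk_of_notMem_of_mem h (w := v) ?_).2
    · simp
    · simpa using hvb a
  have hna : -a ≠ 0 := neg_ne_zero.2 ha
  have e1 : ∀ a : ℤ, a ≠ 0 → Disjoint (half G v) (gen G c ^ a • half G v) := fun a ha => by
    have := (nested (v := v) (g := 1) (h := gen G c ^ a)
      (zpow_notMem_lk hadj ha (by simp))).1 (by simpa using hbH a)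
      (by rw [mem_smul, ← zpow_neg, mul_one]; exact hbH _)
    simpa using this
  have e2 : ((gen G v)⁻¹ • half G v) ∪ ((gen G c ^ a * (gen G v)⁻¹) • half G v) = Set.univ :=
    (nested (v := v) (zpow_notMem_lk hadj ha (by simp))).2.2
      (by rw [mem_smul, inv_inv, ← mul_assoc]; exact hvbv a ha)
      (by
        rw [mem_smul, mul_inv_rev, inv_inv, ← zpow_neg]
        exact hvbv _ hna)
  have e3 : ∀ a : ℤ, gen G c ^ a • half G v ⊆ (gen G v)⁻¹ • half G v := fun a =>
    (nested (v := v) (g := (gen G v)⁻¹) (h := gen G c ^ a)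
      (fun h => notMem_half_of_mem_lk h (by simpa using hvb a))).2.1
      (by rw [mem_smul, inv_inv]; exact hvb a)
      (by rw [mem_smul, ← zpow_neg]; exact hbv _)
  rw [sides] at hg ⊢
  rintro (h | h) <;> rcases hg with hg | hg
  · exact Set.disjoint_left.1 (e1 a ha) h (by simpa [mem_smul] using hg)
  · apply hg
    refine e3 (-a) ?_
    rw [mem_smul, ← zpow_neg, neg_neg]
    exact h
  · exact h (e3 a (by simpa [mem_smul] using hg))
  · have : gen G c ^ a * g ∈ ((gen G v)⁻¹ • half G v) ∪
        ((gen G c ^ a * (gen G v)⁻¹) • half G v) := by rw [e2]; trivial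
    rcases this with h' | h'
    · exact h h'
    · apply hg
      rw [mem_smul] at h' ⊢
      convert h' using 1
      group

theorem smul_half_subset_sides {v : V} {h q : RAAG G} (h1 : (1 : RAAG G) ∉ h • half G v)
    (hq : q ∈ h • half G v) (hq' : q ∈ sides G v) : h • half G v ⊆ sides G v := by
  rcases hq' with hq' | hq'
  · refine subset_trans ?_ Set.subset_union_left
    by_cases he : (1 : RAAG G)⁻¹ * h ∈ lk G v
    · rw [← smul_half_eq_iff.2 he, one_smul]
    · by_cases hh : h ∈ half G v
      · simpa using (nested he).2.1 (by simpa using hh) h1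
      · exact absurd hq (Set.disjoint_left.1
          ((nested he).1 (by simpa using hh) h1) (by simpa using hq'))
  · refine subset_trans ?_ Set.subset_union_right
    by_cases he : ((gen G v)⁻¹)⁻¹ * h ∈ lk G v
    · rw [← smul_half_eq_iff.2 he] at hq
      exact absurd hq hq'
    · have hv : (gen G v)⁻¹ ∉ h • half G v := fun hv => h1 (by
        rw [mem_smul] at hv ⊢
        rw [mul_one]
        exact mul_gen_inv_mem_half_imp v hv)
      by_cases hh : h ∈ (gen G v)⁻¹ • half G v
      · exact absurd ((nested he).2.1 hh hv hq) hq'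
      · exact Set.subset_compl_iff_disjoint_left.2 ((nested he).1 hh hv)

theorem compl_smul_half_subset_sides {v : V} {h q : RAAG G} (h1 : (1 : RAAG G) ∈ h • half G v)
    (hq : q ∉ h • half G v) (hq' : q ∈ sides G v) : (h • half G v)ᶜ ⊆ sides G v := by
  rcases hq' with hq' | hq'
  · refine subset_trans ?_ Set.subset_union_left
    by_cases he : (1 : RAAG G)⁻¹ * h ∈ lk G v
    · rw [← smul_half_eq_iff.2 he, one_smul] at h1
      exact absurd h1 (one_notMem_half v)
    · have he' : h⁻¹ * 1 ∉ lk G v := fun h' => he (by simpa using inv_mem h')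
      by_cases hh : h ∈ half G v
      · rw [Set.compl_subset_iff_union, Set.union_comm]
        simpa using (nested he).2.2 (by simpa using hh) h1
      · exact absurd ((nested he').2.1 h1 (by simpa using hh) (by simpa using hq')) hq
  · refine subset_trans ?_ Set.subset_union_right
    by_cases he : ((gen G v)⁻¹)⁻¹ * h ∈ lk G v
    · rw [← smul_half_eq_iff.2 he]
    · have he' : h⁻¹ * (gen G v)⁻¹ ∉ lk G v := fun h' => he (by simpa using inv_mem h')
      have hv : (gen G v)⁻¹ ∈ h • half G v := by
        rw [mem_smul]
        by_contra hv
        rw [mem_smul] at h1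
        exact he' (mem_lk_of_notMem_of_mem hv (w := v) (by simpa using h1)).2
      by_cases hh : h ∈ (gen G v)⁻¹ • half G v
      · have := (nested he).2.2 hh hv
        have hq2 : q ∈ (gen G v)⁻¹ • half G v ∪ h • half G v := by rw [this]; trivial
        exact absurd hq2 (by simp only [Set.mem_union]; tauto)
      · exact Set.compl_subset_compl.2 ((nested he').2.1 hv hh)

theorem eq_one_or_mem_sides {c v : V} (hadj : ¬G.Adj v c) {p x : RAAG G}
    (hp : p ∈ sides G v) (hps : p ∈ sub G {c, v}) (hx : x = gen G c ∨ x = gen G v ∨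
      x = (gen G c)⁻¹ ∨ x = (gen G v)⁻¹) (hne : c ≠ v) : p * x = 1 ∨ p * x ∈ sides G v := by
  have hcm : gen G c ∈ sub G {v}ᶜ := gen_mem_sub hne
  rw [mem_sides] at hp ⊢
  rw [← mul_assoc]
  have hvs : gen G v ∈ sub G {c, v} := gen_mem_sub (by simp)
  rcases hx with rfl | rfl | rfl | rfl
  · rw [mul_mem_half_of_mem_compl hcm, mul_mem_half_of_mem_compl hcm]
    exact Or.inr hp
  · rcases hp with hp | hp
    · exact Or.inr (Or.inl (mul_gen_mem_half hp v))
    · by_cases h : gen G v * p * gen G v ∈ half G v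
      · left
        have h1 := (mem_lk_of_notMem_of_mem hp h).2
        have h2 := lk_inf_sub_pair hadj h1 (mul_mem hvs hps)
        rw [eq_inv_of_mul_eq_one_right h2, inv_mul_cancel]
      · exact Or.inr (Or.inr h)
  · rw [mul_mem_half_of_mem_compl (inv_mem hcm), mul_mem_half_of_mem_compl (inv_mem hcm)]
    exact Or.inr hp
  · rcases hp with hp | hp
    · by_cases h : p * (gen G v)⁻¹ ∈ half G v
      · exact Or.inr (Or.inl h)
      · left
        have h1 := (mem_lk_of_notMem_of_mem h (w := v) (by simpa using hp)).2
        exact lk_inf_sub_pair hadj h1 (mul_mem hps (inv_mem hvs))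
    · exact Or.inr (Or.inr fun h => hp (mul_gen_inv_mem_half_imp v h))

theorem exists_zpow_mul_sides {c v : V} (hadj : ¬G.Adj v c) (hne : c ≠ v) {g : RAAG G}
    (hg : g ∈ sub G {c, v}) :
    (∃ n : ℤ, g = gen G c ^ n) ∨ ∃ n : ℤ, ∃ p ∈ sides G v, p ∈ sub G {c, v} ∧
      g = gen G c ^ n * p := by
  have hcs : gen G c ∈ sub G {c, v} := gen_mem_sub (by simp)
  have hvs : gen G v ∈ sub G {c, v} := gen_mem_sub (by simp)
  have step : ∀ g x : RAAG G, (x = gen G c ∨ x = gen G v ∨ x = (gen G c)⁻¹ ∨ x = (gen G v)⁻¹) →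
      ((∃ n : ℤ, g = gen G c ^ n) ∨ ∃ n : ℤ, ∃ p ∈ sides G v, p ∈ sub G {c, v} ∧
        g = gen G c ^ n * p) →
      ((∃ n : ℤ, g * x = gen G c ^ n) ∨ ∃ n : ℤ, ∃ p ∈ sides G v, p ∈ sub G {c, v} ∧
        g * x = gen G c ^ n * p) := by
    rintro g x hx (⟨n, rfl⟩ | ⟨n, p, hp, hps, rfl⟩)
    · rcases hx with rfl | rfl | rfl | rfl
      · left; exact ⟨n + 1, by rw [zpow_add_one]⟩
      · right; exact ⟨n, _, Or.inl (gen_mem_half v), hvs, rfl⟩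
      · left; exact ⟨n - 1, by rw [zpow_sub_one]⟩
      · right
        exact ⟨n, _, mem_sides.2 (Or.inr (by simp [one_notMem_half])), inv_mem hvs, rfl⟩
    · rcases eq_one_or_mem_sides hadj hp hps hx hne with h | h
      · left; exact ⟨n, by rw [mul_assoc, h, mul_one]⟩
      · right
        refine ⟨n, _, h, mul_mem hps ?_, mul_assoc _ _ _⟩
        rcases hx with rfl | rfl | rfl | rfl
        · exact hcs
        · exact hvs
        · exact inv_mem hcs
        · exact inv_mem hvs
  induction hg using sub_induction_right with
  | one => left; exact ⟨0, by simp⟩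
  | mul g _ w hw h =>
    refine step g _ ?_ h
    rcases hw with rfl | rfl <;> simp
  | inv g _ w hw h =>
    refine step g _ ?_ h
    rcases hw with rfl | rfl <;> simp

theorem eq_gen_of_pingPong {c v : V} (hadj : ¬G.Adj v c) (hne : c ≠ v) {z h : RAAG G}
    (hz : z ∈ sub G {c, v}) (h1 : z ∈ sides G v) (h2 : z⁻¹ ∈ sides G v)
    (hyp : z • h • half G v ⊂ h • half G v) (hK : (1 : RAAG G) ∈ h • half G v)
    (hzK : (1 : RAAG G) ∉ z • h • half G v)
    (hgen : gen G v ∈ Subgroup.closure {gen G c, z}) : z = gen G v := by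
  have hzK' : (1 : RAAG G) ∉ (z * h) • half G v := by rwa [mul_smul]
  have s1 : z • h • half G v ⊆ sides G v := by
    rw [← mul_smul]
    refine smul_half_subset_sides hzK' (q := z) ?_ h1
    rw [mul_smul, mem_smul, inv_mul_cancel]; exact hK
  have s2 : (h • half G v)ᶜ ⊆ sides G v := by
    refine compl_smul_half_subset_sides hK (q := z⁻¹) (fun h' => hzK ?_) h2
    rw [mem_smul, mul_one]; exact h'
  have key : ∀ g ∈ Subgroup.closure {gen G c, z}, g ∈ sides G v →
      g ∈ z • h • half G v ∪ (h • half G v)ᶜ := by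
    intro g hg hgs
    refine mem_of_pingPong (Set.union_subset s1 s2) (zpow_notMem_sides hne)
      (fun a ha g hg => zpow_mul_notMem_sides hne hadj ha hg) ?_ hg hgs
    intro a ha g hg
    have g1 : g ∈ h • half G v := by by_contra h'; exact hg (s2 h')
    have g2 : g ∉ z • h • half G v := fun h' => hg (s1 h')
    rcases lt_or_gt_of_ne ha with ha | ha
    · right
      intro h'
      apply g2
      have : g ∈ z ^ (-a) • h • half G v := by rw [mem_smul, zpow_neg, inv_inv]; exact h'
      simpa using zpow_smul_antitone hyp.1 (m := 1) (by omega) this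
    · left
      have : z ^ a * g ∈ z ^ a • h • half G v := by rw [mem_smul, inv_mul_cancel_left]; exact g1
      simpa using zpow_smul_antitone hyp.1 (m := 1) (by omega) this
  have hv1 : gen G v ∈ (z * h) • half G v := by
    rw [mul_smul]
    refine (key _ hgen (Or.inl (gen_mem_half v))).resolve_right fun h' => h' ?_
    rw [mem_smul] at hK ⊢
    rw [mul_one] at hK
    exact mul_gen_mem_half hK v
  have e1 : (z * h) • half G v = half G v := by
    rw [mem_smul] at hzK' hv1
    rw [mul_one] at hzK'
    exact smul_half_of_mem_lk (by simpa using inv_mem (mem_lk_of_notMem_of_mem hzK' hv1).2)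
  have hv2 : (gen G v)⁻¹ ∉ h • half G v := by
    have := key _ (inv_mem hgen) (mem_sides.2 (Or.inr (by simp [one_notMem_half])))
    refine this.resolve_left fun h' => ?_
    rw [← mul_smul, e1] at h'
    exact one_notMem_half v (by simpa using mul_gen_mem_half h' v)
  have e2 : h • half G v = (gen G v)⁻¹ • half G v := by
    rw [mem_smul] at hv2 hK
    exact smul_half_eq_iff.2 (mem_lk_of_notMem_of_mem hv2 (w := v) (by simpa using hK)).2
  rw [mul_smul, e2, ← mul_smul] at e1
  have := lk_inf_sub_pair hadj (mem_lk_of_smul_half e1)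
    (mul_mem hz (inv_mem (gen_mem_sub (by simp))))
  exact mul_inv_eq_one.1 this

theorem eq_gen_of_closure {c v : V} (hadj : ¬G.Adj v c) (hne : c ≠ v) {z : RAAG G}
    (hz : z ∈ sub G {c, v}) (h1 : z ∈ sides G v) (h2 : z⁻¹ ∈ sides G v)
    (hgen : gen G v ∈ Subgroup.closure {gen G c, z}) (hex : ex v z ≠ 0) :
    z = gen G v ∨ z⁻¹ = gen G v := by
  have key : ∀ z h : RAAG G, z ∈ sub G {c, v} → z ∈ sides G v → z⁻¹ ∈ sides G v →
      z • h • half G v ⊂ h • half G v → gen G v ∈ Subgroup.closure {gen G c, z} →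
      z = gen G v := by
    intro z h hz h1 h2 hyp hgen
    obtain ⟨n, hn1, hn2⟩ := exists_gap hyp 1
    refine eq_gen_of_pingPong hadj hne hz h1 h2 (h := z ^ n * h) ?_ ?_ ?_ hgen
    · rw [mul_smul, ← mul_smul, ← zpow_one_add, add_comm, zpow_add_one, mul_smul]
      refine ssubset_iff_subset_not_subset.2 ⟨Set.smul_set_mono hyp.1, fun h' => ?_⟩
      exact hyp.2 (Set.smul_set_subset_smul_set_iff.1 h')
    · rw [mul_smul]; exact hn1
    · rw [mul_smul, ← mul_smul, ← zpow_one_add, add_comm]; exact hn2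
  have conj : ∀ h x : RAAG G, (h⁻¹ * x * h) • half G v ⊂ half G v →
      x • h • half G v ⊂ h • half G v := by
    intro h x hx
    have e : x • h • half G v = h • (h⁻¹ * x * h) • half G v := by
      simp only [← mul_smul]; congr 1; group
    rw [e]
    exact ssubset_iff_subset_not_subset.2 ⟨Set.smul_set_mono hx.1, fun h' =>
      hx.2 (Set.smul_set_subset_smul_set_iff.1 h')⟩
  rcases dichotomy v z with ⟨h, hh⟩ | ⟨h, z', rfl | rfl, hz'⟩
  · have := ex_eq_zero_of_mem_sub (w := v) (by simp) hh
    simp at this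
    exact absurd this hex
  · exact Or.inl (key z h hz h1 h2 (conj _ _ hz') hgen)
  · refine Or.inr (key z⁻¹ h (inv_mem hz) h2 (by simpa using h1) (conj _ _ hz') ?_)
    refine (Subgroup.closure_le _).2 ?_ hgen
    rintro x (rfl | rfl)
    · exact Subgroup.subset_closure (by simp)
    · rw [SetLike.mem_coe, ← inv_mem_iff]; exact Subgroup.subset_closure (by simp)

theorem eq_conj_of_closure {c v : V} (hadj : ¬G.Adj v c) (hne : c ≠ v) {y : RAAG G}
    (hy : y ∈ sub G {c, v}) (hgen : gen G v ∈ Subgroup.closure {gen G c, y})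
    (hv : ex v y = 1) (hc : ex c y = 0) :
    ∃ i : ℤ, y = gen G c ^ i * gen G v * (gen G c ^ i)⁻¹ := by
  obtain ⟨n, rfl⟩ | ⟨i, p, hp, hps, rfl⟩ := exists_zpow_mul_sides hadj hne hy
  · simp [ex_gen_ne hne] at hv
  have hcm : ∀ i : ℤ, gen G c ^ i ∈ sub G {v}ᶜ := fun i => zpow_mem (gen_mem_sub hne) _
  have hcs : ∀ i : ℤ, gen G c ^ i ∈ sub G {c, v} := fun i => zpow_mem (gen_mem_sub (by simp)) _
  obtain ⟨j, hj⟩ | ⟨j, q, hq, hqs, hj⟩ := exists_zpow_mul_sides hadj hne (inv_mem hps)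
  · have : p = gen G c ^ (-j) := by rw [zpow_neg, ← hj, inv_inv]
    rw [this] at hp
    exact absurd hp (zpow_notMem_sides hne _)
  have hqp : q⁻¹ = p * gen G c ^ j := by
    rw [← inv_inv p, hj]; group
  have hqs' : q⁻¹ ∈ sides G v := by
    rw [hqp, mem_sides, ← mul_assoc, mul_mem_half_of_mem_compl (hcm j),
      mul_mem_half_of_mem_compl (hcm j), ← mem_sides]
    exact hp
  have hp' : p = q⁻¹ * gen G c ^ (-j) := by rw [hqp]; group
  subst hp'
  have hgen' : gen G v ∈ Subgroup.closure {gen G c, q⁻¹} := by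
    refine (Subgroup.closure_le _).2 ?_ hgen
    have hcc : gen G c ∈ Subgroup.closure {gen G c, q⁻¹} := Subgroup.subset_closure (by simp)
    rintro x (rfl | rfl)
    · exact hcc
    · exact mul_mem (zpow_mem hcc _) (mul_mem (Subgroup.subset_closure (by simp))
        (zpow_mem hcc _))
  simp [ex_gen_ne hne] at hv
  have hz := eq_gen_of_closure hadj hne (inv_mem hqs) hqs' (by simpa using hq) hgen' (by
    simp; omega)
  have hexv : ex v q⁻¹ = 1 := by simp; omega
  rcases hz with hz | hz
  · refine ⟨i, ?_⟩
    rw [hz] at hc ⊢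
    simp [ex_gen_ne hne.symm] at hc
    have : j = i := by omega
    rw [this, zpow_neg, mul_assoc]
  · rw [inv_inv] at hz
    rw [hz] at hexv
    simp at hexv

end RankTwo

section Conjugating

variable {V : Type} {G : SimpleGraph V}

theorem exists_conj_mem_compl {φ : MulAut (RAAG G)} (hex : ∀ w g, ex w (φ g) = ex w g) {u v : V}
    (h : ¬G.neighborSet v ⊆ G.neighborSet u) :
    ∃ g, g⁻¹ * φ (gen G v) * g ∈ sub G {u}ᶜ := by
  obtain ⟨z, hzv, hzu⟩ := Set.not_subset.1 h
  have hzv' : G.Adj v z := hzv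
  refine (dichotomy u (φ (gen G v))).resolve_right ?_
  rintro ⟨g, y, hy, hyH⟩
  have hc : Commute (φ (gen G v)) (φ (gen G z)) := (gen_commute hzv').map φ
  have hc1 : Commute (g⁻¹ * φ (gen G v) * g) (g⁻¹ * φ (gen G z) * g) := by
    simpa using hc.map (MulAut.conj g⁻¹).toMonoidHom
  have hcy : Commute y (g⁻¹ * φ (gen G z) * g) := by
    rcases hy with rfl | rfl
    · exact hc1
    · have e : g⁻¹ * (φ (gen G v))⁻¹ * g = (g⁻¹ * φ (gen G v) * g)⁻¹ := by group
      rw [e]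
      exact hc1.inv_left
  obtain ⟨n, a, ha, hmem⟩ := exists_pow_mem_lk hyH hcy
  have h0 := ex_eq_zero_of_mem_sub hzu hmem
  have hy0 : ex z y = 0 := by
    rcases hy with rfl | rfl <;> simp [hex, ex_gen_ne hzv'.ne]
  simp [hy0, hex] at h0
  exact ha h0

theorem exists_conj_mem_of_finset (x : RAAG G) (F : Finset V)
    (h : ∀ u ∈ F, ∃ g, g⁻¹ * x * g ∈ sub G {u}ᶜ) : ∃ g, g⁻¹ * x * g ∈ sub G {u | u ∉ F} := by
  classical
  induction F using Finset.induction_on with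
  | empty => exact ⟨1, by simp [sub_univ]⟩
  | insert a s ha ih =>
    have := conj_inter (h a (Finset.mem_insert_self _ _))
      (ih fun u hu => h u (Finset.mem_insert_of_mem hu))
    convert this using 4
    ext u
    simp

theorem conj_of_conj_mem_sub_singleton {φ : MulAut (RAAG G)} (hex : ∀ w g, ex w (φ g) = ex w g)
    {v : V} (h : ∃ g, g⁻¹ * φ (gen G v) * g ∈ sub G {v}) :
    ∃ g, φ (gen G v) = g * gen G v * g⁻¹ := by
  obtain ⟨g, hg⟩ := h
  obtain ⟨n, hn⟩ := mem_sub_singleton hg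
  have : n = 1 := by
    have := congrArg (ex v) hn
    simpa [hex] using this.symm
  rw [this, zpow_one] at hn
  exact ⟨g, by rw [eq_mul_inv_iff_mul_eq, ← inv_mul_eq_iff_eq_mul, ← mul_assoc, hn]⟩

/-- An automorphism acting trivially on the abelianization maps every generator to a conjugate,
provided that only `c` dominates other vertices. -/
theorem exists_conj [Fintype V] {c : V} (hdom : ∀ u v : V, u ≠ v → Dominates G u v → u = c)
    {φ : MulAut (RAAG G)} (hex : ∀ w g, ex w (φ g) = ex w g) (v : V) :
    ∃ g, φ (gen G v) = g * gen G v * g⁻¹ := by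
  classical
  have hdom' : ∀ u v : V, u ≠ v → G.neighborSet v ⊆ G.neighborSet u → u = c :=
    fun u v huv h => hdom u v huv (h.trans (Set.subset_insert _ _))
  have simple : ∀ v : V, (∀ u, u ≠ v → ¬G.neighborSet v ⊆ G.neighborSet u) →
      ∃ g, φ (gen G v) = g * gen G v * g⁻¹ := by
    intro v hv
    refine conj_of_conj_mem_sub_singleton hex ?_
    have := exists_conj_mem_of_finset (φ (gen G v)) (Finset.univ.erase v)
      (fun u hu => exists_conj_mem_compl hex (hv u (by simpa using hu)))
    simpa using this
  have pair : ∀ φ : MulAut (RAAG G), (∀ w g, ex w (φ g) = ex w g) → ∀ v,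
      ∃ g, g⁻¹ * φ (gen G v) * g ∈ sub G {c, v} := by
    intro φ hex v
    have := exists_conj_mem_of_finset (φ (gen G v)) ((Finset.univ.erase v).erase c)
      (fun u hu => exists_conj_mem_compl hex (fun h => by
        simp at hu
        exact hu.1 (hdom' u v hu.2 h)))
    convert this using 4
    ext u
    simp
    tauto
  by_cases hvc : v ≠ c ∧ G.neighborSet v ⊆ G.neighborSet c
  swap
  · refine simple v fun u hu h => hvc ?_
    obtain rfl := hdom' u v hu h
    exact ⟨hu.symm, h⟩
  obtain ⟨hne, hsub⟩ := hvc
  have hadj : ¬G.Adj v c := fun h => G.irrefl (hsub h : G.Adj c c)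
  obtain ⟨g₀, hg₀⟩ := simple c fun u hu h => hu (hdom' u c hu h)
  set ψ : MulAut (RAAG G) := MulAut.conj g₀⁻¹ * φ with hψ
  have ψapp : ∀ x, ψ x = g₀⁻¹ * φ x * g₀ := fun x => by simp [hψ]
  have hψex : ∀ w g, ex w (ψ g) = ex w g := fun w g => by rw [ψapp]; simp [hex]
  have hψc : ψ (gen G c) = gen G c := by rw [ψapp, hg₀]; group
  set r := retr G {c, v} with hr
  have hkill : ∀ w, w ≠ c → w ≠ v → r (ψ (gen G w)) = 1 := by
    intro w hwc hwv
    obtain ⟨g, hg⟩ := pair ψ hψex w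
    have h1 := retr_mem_sub_inter (S := {c, v}) hg
    have he : ({c, v} : Set V) ∩ {c, w} = {c} := by
      ext u
      simp only [Set.mem_inter_iff, Set.mem_insert_iff, Set.mem_singleton_iff]
      constructor
      · rintro ⟨h1 | h1, h2 | h2⟩
        · exact h1
        · exact h1
        · exact h2
        · exact absurd (h2.symm.trans h1) hwv
      · rintro rfl; exact ⟨Or.inl rfl, Or.inl rfl⟩
    rw [he] at h1
    obtain ⟨n, hn⟩ := mem_sub_singleton h1
    have h2 := congrArg (ex c) hn
    rw [ex_retr (by simp)] at h2
    simp [hψex, ex_gen_ne hwc] at h2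
    rw [← h2, zpow_zero, map_mul, map_mul, map_inv] at hn
    rw [mul_eq_one_iff_eq_inv, mul_eq_left] at hn
    exact hn
  set y := r (ψ (gen G v)) with hy
  have hcl : ∀ x, r (ψ x) ∈ Subgroup.closure {gen G c, y} := by
    have hgen : ∀ w, r (ψ (gen G w)) ∈ Subgroup.closure {gen G c, y} := by
      intro w
      by_cases hwc : w = c
      · rw [hwc, hψc, hr, retr_gen_mem (by simp)]
        exact Subgroup.subset_closure (by simp)
      · by_cases hwv : w = v
        · rw [hwv]
          exact Subgroup.subset_closure (by simp [hy])
        · rw [hkill w hwc hwv]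
          exact one_mem _
    intro x
    induction x using induction_right with
    | one => simp
    | mul g w h => rw [map_mul, map_mul]; exact mul_mem h (hgen w)
    | inv g w h =>
      rw [map_mul, map_mul, map_inv, map_inv]
      exact mul_mem h (inv_mem (hgen w))
  have hvcl : gen G v ∈ Subgroup.closure {gen G c, y} := by
    have := hcl (ψ⁻¹ (gen G v))
    rwa [MulAut.apply_inv_self, hr, retr_gen_mem (by simp)] at this
  obtain ⟨i, hi⟩ := eq_conj_of_closure hadj hne.symm (retr_mem {c, v} (ψ (gen G v))) hvcl
    (by rw [ex_retr (by simp), hψex, ex_gen_self])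
    (by rw [ex_retr (by simp), hψex, ex_gen_ne hne])
  obtain ⟨g, hg⟩ := pair ψ hψex v
  have h1 := retr_of_mem hg
  simp only [map_mul, map_inv, ← hr, ← hy] at h1
  refine ⟨g₀ * (g * (r g)⁻¹ * gen G c ^ i), ?_⟩
  have h2 : ψ (gen G v) = g * ((r g)⁻¹ * y * r g) * g⁻¹ := by
    rw [h1]; group
  have h3 : φ (gen G v) = g₀ * ψ (gen G v) * g₀⁻¹ := by rw [ψapp]; group
  have hi' : y = gen G c ^ i * gen G v * (gen G c ^ i)⁻¹ := hi
  rw [h3, h2, hi']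
  group

end Conjugating

section Position

variable {V : Type} {G : SimpleGraph V}

theorem exists_pos (v : V) (a : RAAG G) :
    ∃ m : ℤ, ∀ n : ℤ, n < m ↔ (gen G v ^ n)⁻¹ * a ∈ half G v := by
  have hy : gen G v • (1 : RAAG G) • half G v ⊂ (1 : RAAG G) • half G v := by
    simpa using gen_smul_half_ssubset v
  obtain ⟨m, h1, h2⟩ := exists_gap hy a
  simp only [one_smul, mem_smul] at h1 h2
  have hanti := fun m n : ℤ => zpow_smul_antitone (m := m) (n := n) (gen_smul_half_ssubset (G := G) v).le
  refine ⟨m + 1, fun n => ⟨fun h => ?_, fun h => ?_⟩⟩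
  · exact mem_smul.1 (hanti n m (by omega) (mem_smul.2 h1))
  · by_contra hn
    exact h2 (mem_smul.1 (hanti (m + 1) n (by omega) (mem_smul.2 h)))

/-- The position of an element with respect to the chain of walls crossed by the axis of `v`. -/
def pos (v : V) (a : RAAG G) : ℤ := (exists_pos v a).choose

theorem lt_pos_iff {v : V} {a : RAAG G} {n : ℤ} :
    n < pos v a ↔ (gen G v ^ n)⁻¹ * a ∈ half G v := (exists_pos v a).choose_spec n

theorem pos_pos_iff {v : V} {a : RAAG G} : 0 < pos v a ↔ a ∈ half G v := by
  simp [lt_pos_iff]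

theorem pos_nonneg_iff {v : V} {a : RAAG G} : 0 ≤ pos v a ↔ gen G v * a ∈ half G v := by
  have := lt_pos_iff (v := v) (a := a) (n := -1)
  simpa [Int.lt_iff_add_one_le] using this

@[simp] theorem pos_one (v : V) : pos v (1 : RAAG G) = 0 := by
  have h1 : 0 ≤ pos v (1 : RAAG G) := pos_nonneg_iff.2 (by simpa using gen_mem_half v)
  have h2 : ¬0 < pos v (1 : RAAG G) := fun h => one_notMem_half v (pos_pos_iff.1 h)
  omega

theorem pos_zpow_mul (v : V) (a : RAAG G) (m : ℤ) : pos v (gen G v ^ m * a) = m + pos v a := by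
  refine eq_of_forall_lt_iff fun n => ?_
  rw [lt_pos_iff, show n < m + pos v a ↔ n - m < pos v a by omega, lt_pos_iff, ← mul_assoc,
    ← zpow_neg, ← zpow_neg, ← zpow_add]
  congr! 3
  ring

theorem pos_lk_mul {v : V} {k : RAAG G} (hk : k ∈ lk G v) (a : RAAG G) :
    pos v (k * a) = pos v a := by
  refine eq_of_forall_lt_iff fun n => ?_
  rw [lt_pos_iff, lt_pos_iff, ← mul_assoc,
    ← (((commute_of_mem_sub_lk hk).zpow_right n).inv_right).eq, mul_assoc]
  nth_rw 1 [← smul_half_of_mem_lk hk]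
  rw [mem_smul, inv_mul_cancel_left]

theorem pos_mul_of_mem_sub {v : V} {S : Set V} (hv : v ∉ S) {k : RAAG G} (hk : k ∈ sub G S)
    (a : RAAG G) : pos v (a * k) = pos v a := by
  refine eq_of_forall_lt_iff fun n => ?_
  rw [lt_pos_iff, lt_pos_iff, ← mul_assoc, mul_mem_half_of_mem_sub hv hk]

theorem exists_mem_lk_of_mem_sub_star {v : V} {z : RAAG G} (hz : z ∈ sub G (star G v)) :
    ∃ k ∈ lk G v, z = gen G v ^ ex v z * k := by
  have : ∃ n : ℤ, ∃ k ∈ lk G v, z = gen G v ^ n * k := by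
    induction hz using sub_induction_right with
    | one => exact ⟨0, 1, one_mem _, by simp⟩
    | mul g hg u hu ih =>
      obtain ⟨n, k, hk, rfl⟩ := ih
      rcases hu with rfl | hu
      · refine ⟨n + 1, k, hk, ?_⟩
        rw [mul_assoc, (commute_of_mem_sub_lk hk).eq, ← mul_assoc, zpow_add_one]
      · exact ⟨n, _, mul_mem hk (gen_mem_sub hu), by rw [mul_assoc]⟩
    | inv g hg u hu ih =>
      obtain ⟨n, k, hk, rfl⟩ := ih
      rcases hu with rfl | hu
      · refine ⟨n - 1, k, hk, ?_⟩
        rw [mul_assoc, (commute_of_mem_sub_lk hk).inv_right.eq, ← mul_assoc, zpow_sub_one]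
      · exact ⟨n, _, mul_mem hk (inv_mem (gen_mem_sub hu)), by rw [mul_assoc]⟩
  obtain ⟨n, k, hk, rfl⟩ := this
  refine ⟨k, hk, ?_⟩
  simp [ex_eq_zero_of_mem_sub (SimpleGraph.notMem_neighborSet_self G) hk]

/-- Generators and their inverses. -/
def letters (G : SimpleGraph V) : Set (RAAG G) := {x | ∃ w, x = gen G w ∨ x = (gen G w)⁻¹}

theorem mul_letter_of_pos {v : V} {p x : RAAG G} (hx : x ∈ letters G) (hp : pos v p ≤ 0)
    (hpx : 0 < pos v (p * x)) : p * x = gen G v * p := by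
  have h1 : p ∉ half G v := fun h => by have := pos_pos_iff.2 h; omega
  have h2 := pos_pos_iff.1 hpx
  obtain ⟨w, rfl | rfl⟩ := hx
  · obtain ⟨rfl, h⟩ := mem_lk_of_notMem_of_mem h1 h2
    exact (commute_of_mem_sub_lk h).eq
  · exact absurd (mul_gen_mem_half h2 w) (by simpa using h1)

theorem mul_letter_of_neg {v : V} {p x : RAAG G} (hx : x ∈ letters G) (hp : 0 ≤ pos v p)
    (hpx : pos v (p * x) < 0) : p * x = (gen G v)⁻¹ * p := by
  have hx' : x⁻¹ ∈ letters G := by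
    obtain ⟨w, rfl | rfl⟩ := hx
    · exact ⟨w, Or.inr rfl⟩
    · exact ⟨w, Or.inl (by simp)⟩
  have h1 : pos v (gen G v * (p * x)) ≤ 0 := by
    have := pos_zpow_mul v (p * x) 1
    rw [zpow_one] at this
    omega
  have h2 : 0 < pos v (gen G v * (p * x) * x⁻¹) := by
    have := pos_zpow_mul v p 1
    rw [zpow_one] at this
    rw [mul_assoc, mul_assoc, mul_inv_cancel, mul_one]
    omega
  have := mul_letter_of_pos hx' h1 h2
  simp only [mul_assoc, mul_inv_cancel, mul_one, mul_right_inj] at this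
  rw [eq_inv_mul_iff_mul_eq]
  exact this.symm

/-- The elements which are products of `n` letters. -/
def words (G : SimpleGraph V) : ℕ → Set (RAAG G)
  | 0 => {1}
  | n + 1 => {g | ∃ x ∈ letters G, ∃ h ∈ words G n, g = x * h}

theorem words_cross_neg {v : V} {n : ℕ} {p g : RAAG G} (hg : g ∈ words G n) (hp : 0 ≤ pos v p)
    (hpg : pos v (p * g) < 0) : ∃ m, n = m + 1 ∧ p⁻¹ * gen G v * p * g ∈ words G m := by
  induction n generalizing p g with
  | zero =>
    obtain rfl : g = 1 := hg
    rw [mul_one] at hpg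
    omega
  | succ n ih =>
    obtain ⟨x, hx, h, hh, rfl⟩ := hg
    refine ⟨n, rfl, ?_⟩
    by_cases hpx : pos v (p * x) < 0
    · have := mul_letter_of_neg hx hp hpx
      rw [eq_inv_mul_iff_mul_eq] at this
      rw [mul_assoc, ← mul_assoc p, mul_assoc, ← mul_assoc (gen G v), this, inv_mul_cancel_left]
      exact hh
    · obtain ⟨m, rfl, hm⟩ := ih hh (not_lt.1 hpx) (by rwa [mul_assoc])
      exact ⟨x, hx, _, hm, by group⟩

theorem words_cross_pos {v : V} {n : ℕ} {p g : RAAG G} (hg : g ∈ words G n) (hp : pos v p ≤ 0)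
    (hpg : 0 < pos v (p * g)) : ∃ m, n = m + 1 ∧ p⁻¹ * (gen G v)⁻¹ * p * g ∈ words G m := by
  induction n generalizing p g with
  | zero =>
    obtain rfl : g = 1 := hg
    rw [mul_one] at hpg
    omega
  | succ n ih =>
    obtain ⟨x, hx, h, hh, rfl⟩ := hg
    refine ⟨n, rfl, ?_⟩
    by_cases hpx : 0 < pos v (p * x)
    · have := mul_letter_of_pos hx hp hpx
      rw [← inv_mul_eq_iff_eq_mul] at this
      rw [mul_assoc, ← mul_assoc p, mul_assoc, ← mul_assoc (gen G v)⁻¹, this, inv_mul_cancel_left]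
      exact hh
    · obtain ⟨m, rfl, hm⟩ := ih hh (not_lt.1 hpx) (by rwa [mul_assoc])
      exact ⟨x, hx, _, hm, by group⟩

theorem exists_words (g : RAAG G) : ∃ n, g ∈ words G n := by
  suffices ∀ h n, h ∈ words G n → ∃ n, g * h ∈ words G n by simpa using this 1 0 rfl
  induction g using induction_right with
  | one => exact fun h n hn => ⟨n, by simpa using hn⟩
  | mul g w ih =>
    intro h n hn
    rw [mul_assoc]
    exact ih _ (n + 1) ⟨_, ⟨w, Or.inl rfl⟩, h, hn, rfl⟩
  | inv g w ih =>
    intro h n hn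
    rw [mul_assoc]
    exact ih _ (n + 1) ⟨_, ⟨w, Or.inr rfl⟩, h, hn, rfl⟩

theorem star_symm {v w : V} (h : w ∉ star G v) : v ∉ star G w := by
  rintro (rfl | h')
  · exact h (Or.inl rfl)
  · exact h (Or.inr (SimpleGraph.Adj.symm h'))

theorem edgeBdry_pos (v : V) : EdgeBdry {p : RAAG G | 0 < pos v p} (sub G (star G v)) := by
  have h : {p : RAAG G | 0 < pos v p} = half G v := by ext; simp [pos_pos_iff]
  rw [h]
  refine (half_edgeBdry v).mono ?_
  rintro k (hk | hk)
  · exact lk_le_star v hk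
  · simpa using mul_mem (lk_le_star v hk) (gen_mem_sub_star v)

theorem edgeBdry_neg (v : V) : EdgeBdry {p : RAAG G | pos v p < 0} (sub G (star G v)) := by
  have h : {p : RAAG G | pos v p < 0} = ((gen G v)⁻¹ • {p : RAAG G | 0 < pos v p})ᶜ := by
    ext p
    have := pos_zpow_mul v p 1
    rw [zpow_one] at this
    simp only [Set.mem_ofPred_eq, Set.mem_compl_iff, mem_smul, inv_inv, this]
    omega
  rw [h]
  refine ((edgeBdry_pos v).smul _).compl.mono fun k hk => ?_
  rw [mem_smul, inv_inv] at hk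
  simpa using mul_mem (inv_mem (gen_mem_sub_star v)) hk

theorem pos_eq_zero_or {v w : V} (hvw : w ∉ star G v) {g : RAAG G} (h1 : pos v g = 0)
    (h2 : pos w g⁻¹ = 0) (p : RAAG G) : pos v p = 0 ∨ pos w (g⁻¹ * p) = 0 := by
  have key : ∀ a b : Set (RAAG G), EdgeBdry a (sub G (star G v)) → EdgeBdry b (sub G (star G w)) →
      (∀ p ∈ a, pos v p ≠ 0) → (∀ p ∈ b, pos w p ≠ 0) → p ∈ a → g⁻¹ * p ∈ b → False := by
    intro a b ha hb ha' hb' hpa hpb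
    refine Set.disjoint_left.1 (disjoint_of_edgeBdry (p := 1) ha (hb.smul g) ?_ ?_ ?_) hpa
      (mem_smul.2 hpb)
    · rw [Set.disjoint_left]
      intro s hs hsb
      refine hb' _ (mem_smul.1 hsb) ?_
      rw [pos_mul_of_mem_sub hvw hs, h2]
    · rw [Set.disjoint_left]
      intro s hs hsa
      refine ha' _ hsa ?_
      have := pos_mul_of_mem_sub (star_symm hvw) (mem_smul.1 hs) g
      rwa [mul_inv_cancel_left, h1] at this
    · exact fun h => ha' _ h.1 (pos_one v)
  by_contra! h
  rcases lt_or_gt_of_ne h.1 with h3 | h3 <;> rcases lt_or_gt_of_ne h.2 with h4 | h4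
  · exact key _ _ (edgeBdry_neg v) (edgeBdry_neg w) (fun _ h => ne_of_lt h)
      (fun _ h => ne_of_lt h) h3 h4
  · exact key _ _ (edgeBdry_neg v) (edgeBdry_pos w) (fun _ h => ne_of_lt h)
      (fun _ h => ne_of_gt h) h3 h4
  · exact key _ _ (edgeBdry_pos v) (edgeBdry_neg w) (fun _ h => ne_of_gt h)
      (fun _ h => ne_of_lt h) h3 h4
  · exact key _ _ (edgeBdry_pos v) (edgeBdry_pos w) (fun _ h => ne_of_gt h)
      (fun _ h => ne_of_gt h) h3 h4

end Position

section Transvection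

variable {V : Type} {G : SimpleGraph V} {c : V}

/-- Pairs `(a, b)` of integral functions on the vertices, where `a` is supported off the star of
`c` and constant on the components of its complement and `b` is supported on the vertices dominated
by `c`. -/
def weights (G : SimpleGraph V) (c : V) : AddSubgroup ((V → ℤ) × (V → ℤ)) where
  carrier := {f | (∀ v ∈ star G c, f.1 v = 0) ∧
    (∀ v w, v ∉ star G c → w ∉ star G c → G.Adj v w → f.1 v = f.1 w) ∧
    ∀ v, ¬(v ≠ c ∧ Dominates G c v) → f.2 v = 0}
  zero_mem' := by simp
  add_mem' := by
    rintro f g ⟨h1, h2, h3⟩ ⟨h1', h2', h3'⟩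
    refine ⟨fun v hv => ?_, fun v w hv hw hvw => ?_, fun v hv => ?_⟩
    · simp [h1 v hv, h1' v hv]
    · simp [h2 v w hv hw hvw, h2' v w hv hw hvw]
    · simp [h3 v hv, h3' v hv]
  neg_mem' := by
    rintro f ⟨h1, h2, h3⟩
    refine ⟨fun v hv => ?_, fun v w hv hw hvw => ?_, fun v hv => ?_⟩
    · simp [h1 v hv]
    · simp [h2 v w hv hw hvw]
    · simp [h3 v hv]

/-- The image of a vertex under the automorphism with given weights. -/
def transGen (f : weights G c) (v : V) : RAAG G :=
  gen G c ^ f.1.1 v * gen G v * gen G c ^ (f.1.2 v - f.1.1 v)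

theorem transGen_center (f : weights G c) : transGen f c = gen G c := by
  simp [transGen, f.2.1 c (Or.inl rfl), f.2.2.2 c (by simp)]

theorem transGen_of_mem_star (f : weights G c) {v : V} (hv : v ∈ star G c) :
    transGen f v = gen G v * gen G c ^ f.1.2 v := by
  simp [transGen, f.2.1 v hv]

theorem commute_transGen_center (f : weights G c) {v : V} (hv : v ∈ star G c) :
    Commute (transGen f v) (gen G c) := by
  rw [transGen_of_mem_star f hv]
  refine Commute.mul_left ?_ ((Commute.refl _).zpow_left _)
  rcases hv with rfl | hv
  · exact Commute.refl _
  · exact (gen_commute hv).symm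

theorem commute_transGen (f : weights G c) {u v : V} (h : G.Adj u v) :
    Commute (transGen f u) (transGen f v) := by
  have mixed : ∀ u v, G.Adj u v → u ∈ star G c → v ∉ star G c →
      Commute (transGen f u) (transGen f v) := by
    intro u v h hu hv
    have hb : f.1.2 u = 0 := f.2.2.2 u fun hd => hv (hd.2 h)
    have hc := commute_transGen_center f hu
    have hv' : Commute (transGen f u) (gen G v) := by
      rw [transGen_of_mem_star f hu, hb, zpow_zero, mul_one]
      exact gen_commute h
    exact ((hc.zpow_right _).mul_right hv').mul_right (hc.zpow_right _)
  by_cases hu : u ∈ star G c <;> by_cases hv : v ∈ star G c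
  · rw [transGen_of_mem_star f hv]
    have hc := commute_transGen_center f hu
    refine Commute.mul_right ?_ (hc.zpow_right _)
    rw [transGen_of_mem_star f hu]
    refine (gen_commute h).mul_left ?_
    rcases hv with rfl | hv
    · exact (Commute.refl _).zpow_left _
    · exact (gen_commute hv).zpow_left _
  · exact mixed u v h hu hv
  · exact (mixed v u h.symm hv hu).symm
  · have ha := f.2.2.1 u v hu hv h
    have hbu : f.1.2 u = 0 := f.2.2.2 u fun hd => hv (hd.2 h)
    have hbv : f.1.2 v = 0 := f.2.2.2 v fun hd => hu (hd.2 h.symm)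
    have := (gen_commute h).map (MulAut.conj (gen G c ^ f.1.1 v))
    rw [MulAut.conj_apply, MulAut.conj_apply] at this
    simpa [transGen, ha, hbu, hbv] using this

/-- The endomorphism with given weights. -/
def transHom (f : weights G c) : RAAG G →* RAAG G :=
  lift (transGen f) fun _ _ h => commute_transGen f h

@[simp] theorem transHom_gen (f : weights G c) (v : V) :
    transHom f (gen G v) = transGen f v := lift_gen _ _ _

theorem transHom_add (f g : weights G c) : transHom (f + g) = (transHom f).comp (transHom g) := by
  refine hom_ext fun v => ?_
  rw [MonoidHom.comp_apply, transHom_gen, transHom_gen, transGen, transGen, map_mul, map_mul,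
    map_zpow, map_zpow, transHom_gen, transHom_gen, transGen_center, transGen]
  simp only [← mul_assoc, ← zpow_add]
  simp only [mul_assoc, ← zpow_add, AddSubgroup.coe_add, Prod.fst_add, Prod.snd_add, Pi.add_apply]
  congr 1
  · congr 1
    ring
  · congr 2
    ring

theorem transHom_zero : transHom (0 : weights G c) = MonoidHom.id _ :=
  hom_ext fun v => by simp [transGen]

/-- The products of transvections and partial conjugations by `c`. -/
def trans (G : SimpleGraph V) (c : V) : Multiplicative (weights G c) →* MulAut (RAAG G) where
  toFun f := MonoidHom.toMulEquiv (transHom f.toAdd) (transHom (-f.toAdd))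
    (by rw [← transHom_add, neg_add_cancel, transHom_zero])
    (by rw [← transHom_add, add_neg_cancel, transHom_zero])
  map_one' := aut_ext fun v => by simp [transHom_zero]
  map_mul' f g := aut_ext fun v => by simp [transHom_add]

theorem trans_gen (f : Multiplicative (weights G c)) (v : V) :
    trans G c f (gen G v) = gen G c ^ f.toAdd.1.1 v * gen G v *
      gen G c ^ (f.toAdd.1.2 v - f.toAdd.1.1 v) := transHom_gen _ _

end Transvection

section Rigidity

variable {V : Type} {G : SimpleGraph V} {φ : MulAut (RAAG G)} {g : V → RAAG G}

theorem exists_common_conj (hg : ∀ v, φ (gen G v) = g v * gen G v * (g v)⁻¹) {v w : V}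
    (h : G.Adj v w) :
    ∃ s ∈ sub G (star G v), ∃ t ∈ sub G (star G w), g v * s = g w * t := by
  set k := (g v)⁻¹ * g w with hk
  have hc := ((gen_commute h).map φ).map (MulAut.conj (g w)⁻¹).toMonoidHom
  have h1 : Commute (k⁻¹ * gen G v * k) (gen G w) := by
    simpa [hg, hk, mul_assoc] using hc
  have h2 := commute_gen_iff.1 h1.symm
  have h3 := retr_of_mem h2
  rw [map_mul, map_mul, map_inv, retr_gen_mem (show v ∈ star G w from Or.inr h.symm)] at h3
  set r := retr G (star G w) k with hr
  refine ⟨k * r⁻¹, commute_gen_iff.1 ?_, r⁻¹, inv_mem (retr_mem _ _), by simp [hk, mul_assoc]⟩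
  calc gen G v * (k * r⁻¹) = k * (k⁻¹ * gen G v * k) * r⁻¹ := by group
    _ = k * (r⁻¹ * gen G v * r) * r⁻¹ := by rw [h3]
    _ = k * r⁻¹ * gen G v := by group

theorem conj_gen_mem_lk (hg : ∀ v, φ (gen G v) = g v * gen G v * (g v)⁻¹) {v w : V}
    (h : G.Adj v w) : (g v)⁻¹ * φ (gen G w) * g v ∈ lk G v := by
  have hc := ((gen_commute h).map φ).map (MulAut.conj (g v)⁻¹).toMonoidHom
  have h1 : Commute (gen G v) ((g v)⁻¹ * φ (gen G w) * g v) := by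
    rw [hg v] at hc
    simpa [mul_assoc] using hc
  obtain ⟨k, hk, h2⟩ := exists_mem_lk_of_mem_sub_star (commute_gen_iff.1 h1)
  have h3 : ex v ((g v)⁻¹ * φ (gen G w) * g v) = 0 := by
    simp [hg w, ex_gen_ne h.ne']
  rw [h2, h3]
  simpa using hk

theorem pos_eq_of_adj (hg : ∀ v, φ (gen G v) = g v * gen G v * (g v)⁻¹) {u v w : V}
    (hv : v ∉ star G u) (hw : w ∉ star G u) (h : G.Adj v w) (p : RAAG G) :
    pos u (p * g v) = pos u (p * g w) := by
  obtain ⟨s, hs, t, ht, hst⟩ := exists_common_conj hg h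
  rw [← pos_mul_of_mem_sub (star_symm hv) hs, mul_assoc, hst, ← mul_assoc,
    pos_mul_of_mem_sub (star_symm hw) ht]

theorem mul_inv_mem_star (hg : ∀ v, φ (gen G v) = g v * gen G v * (g v)⁻¹) {w : V} {q : RAAG G}
    (hq : φ (gen G w) = q * gen G w * q⁻¹) : (g w)⁻¹ * q ∈ sub G (star G w) := by
  refine commute_gen_iff.1 ?_
  rw [hg w] at hq
  calc gen G w * ((g w)⁻¹ * q) = (g w)⁻¹ * (g w * gen G w * (g w)⁻¹) * q := by group
    _ = (g w)⁻¹ * (q * gen G w * q⁻¹) * q := by rw [hq]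
    _ = (g w)⁻¹ * q * gen G w := by group

theorem pos_head {n : ℕ} {a : RAAG G} (ha : a ∈ words G (n + 1))
    (hmin : ∀ m < n + 1, a ∉ words G m) :
    ∃ w, ∃ e : ℤ, ∃ h ∈ words G n, a = gen G w ^ e * h ∧ pos w a ≠ 0 := by
  obtain ⟨x, ⟨w, hx⟩, h, hh, rfl⟩ := ha
  rcases hx with rfl | rfl
  · refine ⟨w, 1, h, hh, by simp, fun h0 => ?_⟩
    have h1 := pos_zpow_mul w h 1
    rw [zpow_one] at h1
    obtain ⟨m, rfl, hm⟩ := words_cross_neg (v := w) (p := 1) hh (by simp)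
      (by rw [one_mul]; omega)
    exact hmin m (by omega) (by simpa using hm)
  · refine ⟨w, -1, h, hh, by simp, fun h0 => ?_⟩
    have h1 := pos_zpow_mul w h (-1)
    rw [zpow_neg_one] at h1
    obtain ⟨m, rfl, hm⟩ := words_cross_pos (v := w) (p := 1) hh (by simp)
      (by rw [one_mul]; omega)
    exact hmin m (by omega) (by simpa using hm)

theorem exists_pos_ne_zero {a : RAAG G} (ha : a ≠ 1) : ∃ v, pos v a ≠ 0 := by
  classical
  have h := exists_words a
  have h1 := Nat.find_spec h
  have h2 := fun m => Nat.find_min h (m := m)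
  cases h3 : Nat.find h with
  | zero => rw [h3] at h1; exact absurd h1 ha
  | succ n =>
    rw [h3] at h1 h2
    obtain ⟨w, _, _, _, _, hw⟩ := pos_head h1 fun m hm => h2 m hm
    exact ⟨w, hw⟩

theorem pos_map_eq (hg : ∀ v, φ (gen G v) = g v * gen G v * (g v)⁻¹)
    (hstar : ∀ v w, w ∉ star G v → pos v ((g v)⁻¹ * g w) = 0) (h1 : ∀ v, pos v (g v)⁻¹ = 0)
    (a : RAAG G) (v : V) : pos v ((g v)⁻¹ * φ a) = pos v a := by
  obtain ⟨n, ha⟩ := exists_words a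
  induction n using Nat.strong_induction_on generalizing a v with
  | _ n ih =>
  by_cases hmin : ∃ m < n, a ∈ words G m
  · obtain ⟨m, hm, ham⟩ := hmin
    exact ih m hm a v ham
  push Not at hmin
  cases n with
  | zero =>
    obtain rfl : a = 1 := ha
    simp [h1]
  | succ n =>
    obtain ⟨w, e, h, hh, rfl, hw⟩ := pos_head ha hmin
    have IH := fun v => ih n (by omega) h v hh
    have hww : pos w ((g w)⁻¹ * φ (gen G w ^ e * h)) = pos w (gen G w ^ e * h) := by
      rw [pos_zpow_mul, ← IH w, ← pos_zpow_mul, map_mul, map_zpow, hg w, conj_zpow]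
      congr 1
      group
    by_cases hvw : v ∈ star G w
    · rcases hvw with rfl | hvw
      · exact hww
      · have hk := zpow_mem (conj_gen_mem_lk hg (SimpleGraph.Adj.symm hvw)) e
        have hk' := zpow_mem (gen_mem_sub (G := G) (S := G.neighborSet v)
          (SimpleGraph.Adj.symm hvw)) e
        rw [pos_lk_mul hk', ← IH v, ← pos_lk_mul hk ((g v)⁻¹ * φ h)]
        congr 1
        have := conj_zpow (i := e) (a := (g v)⁻¹) (b := φ (gen G w))
        rw [inv_inv] at this
        rw [this, map_mul, map_zpow]
        group
    · have hvw' := star_symm hvw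
      have e1 : pos v (gen G w ^ e * h) = 0 := by
        refine (pos_eq_zero_or hvw' (g := 1) (by simp) (by simp) _).resolve_right ?_
        simpa using hw
      have e2 : pos v ((g v)⁻¹ * φ (gen G w ^ e * h)) = 0 := by
        refine (pos_eq_zero_or hvw' (g := (g v)⁻¹ * g w) (hstar v w hvw') ?_ _).resolve_right ?_
        · rw [mul_inv_rev, inv_inv]
          exact hstar w v hvw
        · rw [← hww] at hw
          simpa [mul_assoc] using hw
      rw [e1, e2]

theorem eq_one_of_pos (hg : ∀ v, φ (gen G v) = g v * gen G v * (g v)⁻¹)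
    (hstar : ∀ v w, w ∉ star G v → pos v ((g v)⁻¹ * g w) = 0) (h1 : ∀ v, pos v (g v)⁻¹ = 0) :
    φ = 1 := by
  have key := pos_map_eq hg hstar h1
  refine aut_ext fun u => ?_
  have hu : ∀ v, v ≠ u → pos v (φ⁻¹ (gen G u)) = 0 := by
    intro v hv
    rw [← key, MulAut.apply_inv_self,
      pos_mul_of_mem_sub (S := {u}) (by simpa using hv) (gen_mem_sub rfl), h1]
  have hne : φ⁻¹ (gen G u) ≠ 1 := by
    rw [Ne, map_eq_one_iff _ (MulEquiv.injective _)]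
    intro h
    have := congrArg (ex u) h
    simp at this
  obtain ⟨w, hw⟩ := exists_pos_ne_zero hne
  obtain rfl : w = u := by
    by_contra h
    exact hw (hu w h)
  rw [← key, MulAut.apply_inv_self] at hw
  rw [MulAut.one_apply, hg]
  have hl : gen G w ∈ letters G := ⟨w, Or.inl rfl⟩
  rcases lt_or_gt_of_ne hw with h | h
  · have := congrArg (ex w) (mul_letter_of_neg hl (h1 w).ge h)
    simp at this
    omega
  · have := mul_letter_of_pos hl (h1 w).le h
    rw [← mul_inv_eq_iff_eq_mul, inv_inv, mul_assoc, inv_mul_eq_iff_eq_mul] at this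
    rw [mul_inv_eq_iff_eq_mul, this]

end Rigidity

section Centering

variable {V : Type} {G : SimpleGraph V} {φ : MulAut (RAAG G)} {g : V → RAAG G}

/-- If `p` is not in the strip of `v`, then moving it towards this strip along the axis of `φ v`
shortens the words leading from `p` to points of the strip. -/
theorem exists_shortening (hg : ∀ v, φ (gen G v) = g v * gen G v * (g v)⁻¹) {v : V} {p : RAAG G}
    (hp : pos v ((g v)⁻¹ * p) ≠ 0) :
    ∃ y, (y = φ (gen G v) ∨ y = (φ (gen G v))⁻¹) ∧
      ∀ q n, pos v ((g v)⁻¹ * q) = 0 → p⁻¹ * q ∈ words G n →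
        ∃ m, n = m + 1 ∧ (y * p)⁻¹ * q ∈ words G m := by
  rcases lt_or_gt_of_ne hp with h | h
  · refine ⟨_, Or.inl rfl, fun q n hq hn => ?_⟩
    have h1 := pos_zpow_mul v ((g v)⁻¹ * p) 1
    have h2 := pos_zpow_mul v ((g v)⁻¹ * q) 1
    rw [zpow_one] at h1 h2
    obtain ⟨m, rfl, hm⟩ := words_cross_pos (v := v) (p := gen G v * ((g v)⁻¹ * p)) hn (by omega)
      (by rw [show gen G v * ((g v)⁻¹ * p) * (p⁻¹ * q) = gen G v * ((g v)⁻¹ * q) by group]; omega)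
    refine ⟨m, rfl, ?_⟩
    convert hm using 1
    rw [hg v]
    group
  · refine ⟨_, Or.inr rfl, fun q n hq hn => ?_⟩
    have h1 := pos_zpow_mul v ((g v)⁻¹ * p) (-1)
    have h2 := pos_zpow_mul v ((g v)⁻¹ * q) (-1)
    rw [zpow_neg_one] at h1 h2
    obtain ⟨m, rfl, hm⟩ := words_cross_neg (v := v) (p := (gen G v)⁻¹ * ((g v)⁻¹ * p)) hn
      (by omega)
      (by
        rw [show (gen G v)⁻¹ * ((g v)⁻¹ * p) * (p⁻¹ * q) = (gen G v)⁻¹ * ((g v)⁻¹ * q) by group]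
        omega)
    refine ⟨m, rfl, ?_⟩
    convert hm using 1
    rw [hg v]
    group

theorem exists_center [Fintype V] (hg : ∀ v, φ (gen G v) = g v * gen G v * (g v)⁻¹)
    (hstar : ∀ v w, w ∉ star G v → pos v ((g v)⁻¹ * g w) = 0)
    (hne : ∀ v, ∃ w, w ∉ star G v) : ∃ p, ∀ v, pos v ((g v)⁻¹ * p) = 0 := by
  classical
  have hex : ∃ N : ℕ, ∃ p : RAAG G, ∃ n : V → ℕ, ∑ w, n w = N ∧
      ∀ w, ∃ q, φ (gen G w) = q * gen G w * q⁻¹ ∧ p⁻¹ * q ∈ words G (n w) := by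
    choose n hn using fun w => exists_words (g w)
    exact ⟨_, 1, n, rfl, fun w => ⟨g w, hg w, by simpa using hn w⟩⟩
  obtain ⟨p, n, hsum, hpn⟩ := Nat.find_spec hex
  have hmin := fun N => Nat.find_min hex (m := N)
  rw [← hsum] at hmin
  refine ⟨p, fun v => ?_⟩
  by_contra hv
  obtain ⟨y, hy, hshort⟩ := exists_shortening hg hv
  have key : ∀ w, ∃ m, m ≤ n w ∧ (w ∉ star G v → m < n w) ∧
      ∃ q, φ (gen G w) = q * gen G w * q⁻¹ ∧ (y * p)⁻¹ * q ∈ words G m := by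
    intro w
    obtain ⟨q, hq, hw⟩ := hpn w
    by_cases hvw : w ∈ star G v
    · refine ⟨n w, le_rfl, fun h => absurd hvw h, y * q, ?_, by simpa [mul_assoc] using hw⟩
      have h1 : Commute (gen G v) (gen G w) := commute_gen_iff.2 (gen_mem_sub hvw)
      have h2 : Commute y (φ (gen G w)) := by
        rcases hy with rfl | rfl
        · exact h1.map φ
        · exact (h1.map φ).inv_left
      rw [mul_inv_rev, mul_assoc y, mul_assoc y, ← mul_assoc _ q⁻¹, ← hq, ← mul_assoc, h2.eq,
        mul_inv_cancel_right]
    · have h0 : pos v ((g v)⁻¹ * q) = 0 := by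
        have := pos_mul_of_mem_sub (star_symm hvw) (mul_inv_mem_star hg hq) ((g v)⁻¹ * g w)
        rw [hstar v w hvw] at this
        rw [← this]
        congr 1
        group
      obtain ⟨m, hm, hmq⟩ := hshort q (n w) h0 hw
      exact ⟨m, by omega, fun _ => by omega, q, hq, hmq⟩
  choose m hm1 hm2 hm3 using key
  obtain ⟨w, hw⟩ := hne v
  exact hmin (∑ w, m w)
    (Finset.sum_lt_sum (fun i _ => hm1 i) ⟨w, Finset.mem_univ _, hm2 w hw⟩) ⟨y * p, m, rfl, hm3⟩

theorem mem_inn_of_pos [Fintype V] (hg : ∀ v, φ (gen G v) = g v * gen G v * (g v)⁻¹)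
    (hstar : ∀ v w, w ∉ star G v → pos v ((g v)⁻¹ * g w) = 0)
    (hne : ∀ v, ∃ w, w ∉ star G v) : φ ∈ Inn (RAAG G) := by
  obtain ⟨p, hp⟩ := exists_center hg hstar hne
  refine ⟨p, ?_⟩
  suffices MulAut.conj p⁻¹ * φ = 1 by rwa [map_inv, inv_mul_eq_one] at this
  refine eq_one_of_pos (g := fun v => p⁻¹ * g v) (fun v => ?_) (fun v w hvw => ?_) fun v => ?_
  · rw [MulAut.mul_apply, MulAut.conj_apply, hg]
    group
  · rw [← hstar v w hvw]
    congr 1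
    group
  · rw [← hp v]
    congr 1
    group

theorem eq_of_connected {S : Set V} (hS : (G.induce S).Connected) {f : V → ℤ}
    (hf : ∀ v w, v ∈ S → w ∈ S → G.Adj v w → f v = f w) {v w : V} (hv : v ∈ S) (hw : w ∈ S) :
    f v = f w := by
  obtain ⟨p⟩ := hS.preconnected ⟨v, hv⟩ ⟨w, hw⟩
  have : ∀ x y : S, (G.induce S).Walk x y → f x = f y := by
    intro x y p
    induction p with
    | nil => rfl
    | cons h _ ih => exact (hf _ _ (Subtype.coe_prop _) (Subtype.coe_prop _) h).trans ih
  exact this _ _ p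

/-- In a focused graph, an automorphism mapping every generator to a conjugate is a product of an
inner automorphism and partial conjugations by the focus. -/
theorem exists_trans_of_conj [Fintype V] {c : V} (hF : Focused G c)
    (hc : ((star G c)ᶜ : Set V).Nonempty) (hg : ∀ v, ∃ g, φ (gen G v) = g * gen G v * g⁻¹) :
    ∃ f, φ * trans G c f ∈ Inn (RAAG G) := by
  classical
  choose g hg using hg
  set a : V → ℤ := fun v => if v ∈ star G c then 0 else -pos c ((g c)⁻¹ * g v) with ha
  have ha0 : ∀ v ∈ star G c, a v = 0 := fun v hv => by simp [ha, hv]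
  have ha1 : ∀ v, v ∉ star G c → a v = -pos c ((g c)⁻¹ * g v) := fun v hv => by simp [ha, hv]
  let f : weights G c := ⟨(a, 0), ha0, fun v w hv hw h => by
    simp only [ha1 v hv, ha1 w hw, pos_eq_of_adj hg hv hw h], fun _ _ => rfl⟩
  refine ⟨Multiplicative.ofAdd f, ?_⟩
  set ψ := φ * trans G c (Multiplicative.ofAdd f) with hψ
  set g₁ : V → RAAG G := fun v => φ (gen G c) ^ a v * g v with hg₁
  have hψ₁ : ∀ v, ψ (gen G v) = g₁ v * gen G v * (g₁ v)⁻¹ := by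
    intro v
    rw [hψ, MulAut.mul_apply, trans_gen]
    simp only [f, toAdd_ofAdd, map_mul, map_zpow, hg₁, hg v, Pi.zero_apply]
    group
  have hstar₁ : ∀ w, w ∉ star G c → pos c ((g₁ c)⁻¹ * g₁ w) = 0 := by
    intro w hw
    have e : (g₁ c)⁻¹ * g₁ w = gen G c ^ a w * ((g c)⁻¹ * g w) := by
      simp only [hg₁, ha0 c (Or.inl rfl), hg c, conj_zpow]
      group
    rw [e, pos_zpow_mul, ha1 w hw]
    omega
  have hd : ∀ v, ∃ d : ℤ, (v = c → d = 0) ∧ ∀ w, w ∉ star G v → pos v ((g₁ v)⁻¹ * g₁ w) = d := by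
    intro v
    by_cases hv : v = c
    · subst hv
      exact ⟨0, fun _ => rfl, hstar₁⟩
    · have hconn := hF.2 v hv
      obtain ⟨⟨w₀, hw₀⟩⟩ := hconn.nonempty
      have hadj : ∀ x y, x ∈ (star G v)ᶜ → y ∈ (star G v)ᶜ → G.Adj x y →
          pos v ((g₁ v)⁻¹ * g₁ x) = pos v ((g₁ v)⁻¹ * g₁ y) :=
        fun x y hx hy h => pos_eq_of_adj hψ₁ hx hy h (g₁ v)⁻¹
      exact ⟨pos v ((g₁ v)⁻¹ * g₁ w₀), fun h => absurd h hv, fun w hw =>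
        eq_of_connected (f := fun w => pos v ((g₁ v)⁻¹ * g₁ w)) hconn hadj hw hw₀⟩
  choose d hd0 hd1 using hd
  refine mem_inn_of_pos (g := fun v => g₁ v * gen G v ^ d v) (fun v => ?_) (fun v w hw => ?_)
    fun v => ?_
  · rw [hψ₁]
    group
  · have hwv : v ∉ ({w} : Set V) := fun h => hw (Or.inl h.symm)
    have hmem : gen G w ^ d w ∈ sub G {w} := zpow_mem (gen_mem_sub (Set.mem_singleton w)) _
    rw [← mul_assoc, pos_mul_of_mem_sub hwv hmem, mul_inv_rev, ← zpow_neg,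
      mul_assoc, pos_zpow_mul, hd1 v w hw]
    omega
  · by_cases hv : v = c
    · subst hv
      exact hc
    · obtain ⟨⟨w₀, hw₀⟩⟩ := (hF.2 v hv).nonempty
      exact ⟨w₀, hw₀⟩

end Centering

section Abelianization

variable {V : Type} {G : SimpleGraph V}

open Classical in
/-- The action on `ℤ × ℤ` through which the generators `s` and `t` generate a Heisenberg group. -/
def heisenbergGen (s t u : V) : Equiv.Perm (ℤ × ℤ) :=
  if u = s then ⟨fun p => (p.1, p.2 + p.1), fun p => (p.1, p.2 - p.1), fun p => by simp,
    fun p => by simp⟩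
  else if u = t then ⟨fun p => (p.1 + 1, p.2), fun p => (p.1 - 1, p.2), fun p => by simp,
    fun p => by simp⟩
  else 1

theorem commute_heisenbergGen {s t : V} (hst : ¬G.Adj s t) {u v : V} (h : G.Adj u v) :
    Commute (heisenbergGen s t u) (heisenbergGen s t v) := by
  have hne := h.ne
  have hst' : ¬G.Adj t s := fun h => hst h.symm
  by_cases hus : u = s
  · subst hus
    have : heisenbergGen u t v = 1 := by
      rw [heisenbergGen, if_neg hne.symm, if_neg (by rintro rfl; exact hst h)]
    rw [this]
    exact Commute.one_right _
  by_cases hut : u = t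
  · subst hut
    have : heisenbergGen s u v = 1 := by
      rw [heisenbergGen, if_neg (by rintro rfl; exact hst' h), if_neg hne.symm]
    rw [this]
    exact Commute.one_right _
  have : heisenbergGen s t u = 1 := by rw [heisenbergGen, if_neg hus, if_neg hut]
  rw [this]
  exact Commute.one_left _

theorem heisenbergGen_apply {s t : V} (hne : s ≠ t) (u : V) (p : ℤ × ℤ) :
    heisenbergGen s t u p = (p.1 + ex t (gen G u), p.2 + ex s (gen G u) * p.1) := by
  by_cases hus : u = s
  · subst hus
    simp [heisenbergGen, ex_gen_ne hne]
  by_cases hut : u = t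
  · subst hut
    simp [heisenbergGen, hne.symm, ex_gen_ne hne.symm]
  · simp [heisenbergGen, hus, hut, ex_gen_ne hus, ex_gen_ne hut]

theorem ex_mul_ex_of_commute {s t : V} (hne : s ≠ t) (hst : ¬G.Adj s t) {x y : RAAG G}
    (h : Commute x y) : ex s x * ex t y = ex t x * ex s y := by
  set F : RAAG G →* Equiv.Perm (ℤ × ℤ) :=
    lift (heisenbergGen s t) fun u v h => commute_heisenbergGen hst h with hF
  have hgen : ∀ u p, F (gen G u) p = (p.1 + ex t (gen G u), p.2 + ex s (gen G u) * p.1) := by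
    intro u p
    rw [hF, lift_gen, heisenbergGen_apply hne]
  have key : ∀ g : RAAG G, ∃ q : ℤ, ∀ p, F g p = (p.1 + ex t g, p.2 + ex s g * p.1 + q) := by
    intro g
    induction g using induction_right with
    | one => exact ⟨0, by simp⟩
    | mul g u ih =>
      obtain ⟨q, hq⟩ := ih
      refine ⟨q + ex s g * ex t (gen G u), fun p => ?_⟩
      rw [map_mul, Equiv.Perm.mul_apply, hgen, hq, ex_mul, ex_mul]
      ext <;> simp only <;> ring
    | inv g u ih =>
      obtain ⟨q, hq⟩ := ih
      refine ⟨q - ex s g * ex t (gen G u) + ex s (gen G u) * ex t (gen G u), fun p => ?_⟩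
      have : (F (gen G u))⁻¹ p = (p.1 - ex t (gen G u),
          p.2 - ex s (gen G u) * (p.1 - ex t (gen G u))) := by
        rw [Equiv.Perm.inv_eq_iff_eq, hgen]
        simp
      rw [map_mul, map_inv, Equiv.Perm.mul_apply, this, hq, ex_mul, ex_mul, ex_inv, ex_inv]
      ext <;> simp only <;> ring
  obtain ⟨q, hq⟩ := key x
  obtain ⟨r, hr⟩ := key y
  have h1 := congrArg (fun f => (F f (0, 0)).2) h.eq
  simp only [map_mul, Equiv.Perm.mul_apply, hq, hr] at h1
  linarith

end Abelianization

section LinearAlgebra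

variable {V : Type} {G : SimpleGraph V}

open Classical in
theorem exists_perm_of_det_ne_zero [Fintype V] {M : Matrix V V ℚ} (hM : M.det ≠ 0) :
    ∃ σ : Equiv.Perm V, ∀ v, M (σ v) v ≠ 0 := by
  by_contra! h
  refine hM ?_
  rw [Matrix.det_apply]
  refine Finset.sum_eq_zero fun σ _ => ?_
  obtain ⟨v, hv⟩ := h σ
  rw [Finset.prod_eq_zero (f := fun i => M (σ i) i) (Finset.mem_univ v) hv, smul_zero]

/-- The vectors proportional to `x` on any pair of distinct nonadjacent vertices. -/
def centralizerSpace (G : SimpleGraph V) (x : V → ℚ) : Submodule ℚ (V → ℚ) where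
  carrier := {y | ∀ s t, s ≠ t → ¬G.Adj s t → x s * y t = x t * y s}
  zero_mem' := by simp
  add_mem' := by
    intro y z hy hz s t hst h
    simp only [Pi.add_apply, mul_add, hy s t hst h, hz s t hst h]
  smul_mem' := by
    intro a y hy s t hst h
    have := hy s t hst h
    simp only [Pi.smul_apply, smul_eq_mul]
    linear_combination a * this

theorem eq_zero_of_mem_centralizerSpace {x y : V → ℚ} (hy : y ∈ centralizerSpace G x) {r t : V}
    (hr : x r ≠ 0) (hyr : y r = 0) (ht : t ∉ star G r) : y t = 0 := by
  have h1 : r ≠ t := fun h => ht (Or.inl h.symm)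
  have h2 : ¬G.Adj r t := fun h => ht (Or.inr h)
  have := hy r t h1 h2
  rw [hyr, mul_zero] at this
  exact (mul_eq_zero.1 this).resolve_left hr

open Classical in
theorem monomial_of_det_ne_zero [Fintype V] {M : Matrix V V ℚ} (hM : M.det ≠ 0)
    (hcomm : ∀ v w, G.Adj v w → ∀ s t, s ≠ t → ¬G.Adj s t → M s v * M t w = M t v * M s w) :
    ∃ σ : Equiv.Perm V, (∀ v, M (σ v) v ≠ 0) ∧
      (∀ v, Fintype.card (star G v) = Fintype.card (star G (σ v))) ∧
      ∀ v t, t ≠ σ v → M t v ≠ 0 → Dominates G t (σ v) := by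
  obtain ⟨σ, hσ⟩ := exists_perm_of_det_ne_zero hM
  have hli : LinearIndependent ℚ M.col := Matrix.linearIndependent_cols_of_det_ne_zero hM
  have hmem : ∀ v, Submodule.span ℚ (Set.range fun w : star G v => M.col w) ≤
      centralizerSpace G (M.col v) := by
    intro v
    rw [Submodule.span_le]
    rintro _ ⟨⟨w, rfl | hw⟩, rfl⟩
    · intro s t _ _
      exact mul_comm _ _
    · exact hcomm v w hw
  have hres : ∀ v, LinearIndependent ℚ
      (LinearMap.funLeft ℚ ℚ (Subtype.val : star G (σ v) → V) ∘ fun w : star G v => M.col w) := by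
    intro v
    refine (hli.comp _ Subtype.val_injective).map ?_
    rw [Submodule.disjoint_def]
    intro y hy hy0
    have hy' := hmem v hy
    have h0 : ∀ t ∈ star G (σ v), y t = 0 := fun t ht => congrFun hy0 ⟨t, ht⟩
    ext t
    by_cases ht : t ∈ star G (σ v)
    · exact h0 t ht
    · exact eq_zero_of_mem_centralizerSpace hy' (hσ v) (h0 _ (Or.inl rfl)) ht
  have hle : ∀ v, Fintype.card (star G v) ≤ Fintype.card (star G (σ v)) := by
    intro v
    simpa using (hres v).fintype_card_le_finrank
  have hcard : ∀ v, Fintype.card (star G v) = Fintype.card (star G (σ v)) := by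
    have := (Finset.sum_eq_sum_iff_of_le (s := Finset.univ) fun v _ => hle v).1
      (Equiv.sum_comp σ fun v => Fintype.card (star G v)).symm
    exact fun v => this v (Finset.mem_univ v)
  refine ⟨σ, hσ, hcard, fun v t ht hMt u hu => ?_⟩
  by_contra hut
  have : Nonempty (star G v) := ⟨⟨v, Or.inl rfl⟩⟩
  have htop := (hres v).span_eq_top_of_card_eq_finrank (by simp [hcard v])
  rw [Set.range_comp, ← Submodule.map_span] at htop
  have hus : u ∈ star G (σ v) := Or.inr hu
  have : (Pi.single ⟨u, hus⟩ 1 : star G (σ v) → ℚ) ∈ (⊤ : Submodule ℚ _) := trivial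
  rw [← htop] at this
  obtain ⟨y, hy, hyu⟩ := this
  have hy' := hmem v hy
  have hyv : ∀ z ∈ star G (σ v), z ≠ u → y z = 0 := by
    intro z hz hzu
    have := congrFun hyu ⟨z, hz⟩
    rw [Pi.single_eq_of_ne (by simpa using hzu)] at this
    exact this
  have hyu' : y u = 1 := by
    have := congrFun hyu ⟨u, hus⟩
    rw [Pi.single_eq_same] at this
    exact this
  have htu : t ≠ u := fun h => hut (Or.inl h.symm)
  have hyt : y t = 0 := by
    by_cases hts : t ∈ star G (σ v)
    · exact hyv t hts htu
    · exact eq_zero_of_mem_centralizerSpace hy' (hσ v)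
        (hyv _ (Or.inl rfl) (SimpleGraph.Adj.ne hu)) hts
  have := hy' t u htu fun h => hut (Or.inr h)
  rw [hyt, hyu', mul_one, mul_zero] at this
  exact hMt this

end LinearAlgebra

section Sign

variable {V : Type} [Fintype V] {G : SimpleGraph V}

theorem ex_map (φ : RAAG G →* RAAG G) (w : V) (g : RAAG G) :
    ex w (φ g) = ∑ u, ex w (φ (gen G u)) * ex u g := by
  classical
  have hgen : ∀ v, ∑ u, ex w (φ (gen G u)) * ex u (gen G v) = ex w (φ (gen G v)) := by
    intro v
    rw [Finset.sum_eq_single v (fun u _ hu => by rw [ex_gen_ne hu.symm, mul_zero]) (by simp)]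
    simp
  induction g using induction_right with
  | one => simp
  | mul g v ih => simp [mul_add, Finset.sum_add_distrib, ih, hgen]
  | inv g v ih => simp [mul_add, Finset.sum_add_distrib, ih, hgen]

theorem ex_mulAut_map (φ : MulAut (RAAG G)) (w : V) (g : RAAG G) :
    ex w (φ g) = ∑ u, ex w (φ (gen G u)) * ex u g :=
  ex_map φ.toMonoidHom w g

/-- The matrix of the action of an endomorphism on the abelianization. -/
def exMatrix (φ : MulAut (RAAG G)) : Matrix V V ℚ := Matrix.of fun w v => (ex w (φ (gen G v)) : ℚ)

open Classical in
theorem exMatrix_det_ne_zero (φ : MulAut (RAAG G)) : (exMatrix φ).det ≠ 0 := by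
  have : exMatrix φ * exMatrix φ⁻¹ = 1 := by
    ext w v
    have := ex_mulAut_map φ w (φ⁻¹ (gen G v))
    rw [MulAut.apply_inv_self, ex_gen] at this
    rw [Matrix.mul_apply, Matrix.one_apply]
    simp only [exMatrix, Matrix.of_apply]
    have h := congrArg (Int.cast : ℤ → ℚ) this
    push_cast at h
    rw [← h]
    simp [eq_comm]
  intro h
  have := congrArg Matrix.det this
  rw [Matrix.det_mul, h, zero_mul, Matrix.det_one] at this
  exact zero_ne_one this

/-- Modulo commutators, an automorphism maps a vertex to a multiple of itself, up to powers of the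
focus. -/
theorem eq_of_ex_ne_zero {c : V} (hF : Focused G c) (hT : TrivialAut G) (φ : MulAut (RAAG G))
    {v w : V} (hwv : w ≠ v) (h : ex w (φ (gen G v)) ≠ 0) : w = c ∧ Dominates G c v := by
  classical
  have hcomm : ∀ v w, G.Adj v w → ∀ s t, s ≠ t → ¬G.Adj s t →
      exMatrix φ s v * exMatrix φ t w = exMatrix φ t v * exMatrix φ s w := by
    intro v w hvw s t hst hadj
    have := ex_mul_ex_of_commute hst hadj ((gen_commute hvw).map φ)
    simp only [exMatrix, Matrix.of_apply]
    exact_mod_cast this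
  obtain ⟨σ, hσ, hcard, hdom⟩ := monomial_of_det_ne_zero (exMatrix_det_ne_zero φ) hcomm
  have hfocus : ∀ v t, t ≠ σ v → exMatrix φ t v ≠ 0 → t = c :=
    fun v t ht hM => hF.1 t (σ v) ht (hdom v t ht hM)
  have hadj : ∀ v w, G.Adj v w → G.Adj (σ v) (σ w) := by
    intro v w hvw
    by_contra hn
    have hne : σ v ≠ σ w := fun h => hvw.ne (σ.injective h)
    have hM := mul_ne_zero (hσ v) (hσ w)
    rw [hcomm v w hvw _ _ hne hn] at hM
    exact hne ((hfocus w _ hne (right_ne_zero_of_mul hM)).trans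
      (hfocus v _ hne.symm (left_ne_zero_of_mul hM)).symm)
  have hstar : ∀ v, σ '' star G v = star G (σ v) := by
    intro v
    refine Set.eq_of_subset_of_card_le ?_ ?_
    · rintro _ ⟨w, rfl | hw, rfl⟩
      · exact Or.inl rfl
      · exact Or.inr (hadj _ _ hw)
    · rw [← hcard, Set.card_image_of_injective _ σ.injective]
  let e : G ≃g G := ⟨σ, fun {v w} => ⟨fun h => by
    have h1 : σ w ∈ σ '' star G v := by rw [hstar]; exact Or.inr h
    obtain ⟨x, hx, hxw⟩ := h1
    obtain rfl := σ.injective hxw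
    rcases hx with rfl | hx
    · exact absurd h (SimpleGraph.irrefl G)
    · exact hx, hadj v w⟩⟩
  have hid : ∀ v, σ v = v := fun v => hT e v
  have h' : exMatrix φ w v ≠ 0 := by simpa [exMatrix] using h
  have hd := hdom v w (by rwa [hid]) h'
  rw [hid] at hd
  obtain rfl := hF.1 w v hwv hd
  exact ⟨rfl, hd⟩

/-- The diagonal of the action of an automorphism on the abelianization. -/
def diagHom {c : V} (hF : Focused G c) (hT : TrivialAut G) : MulAut (RAAG G) →* (V → ℤ) where
  toFun φ v := ex v (φ (gen G v))
  map_one' := by ext; simp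
  map_mul' φ ψ := by
    ext v
    rw [Pi.mul_apply, MulAut.mul_apply, ex_mulAut_map]
    refine Finset.sum_eq_single v (fun u _ hu => ?_) (by simp)
    by_contra h
    have h1 := (eq_of_ex_ne_zero hF hT φ hu.symm (left_ne_zero_of_mul h)).1
    have h2 := (eq_of_ex_ne_zero hF hT ψ hu (right_ne_zero_of_mul h)).1
    exact hu (h2.trans h1.symm)

/-- The signs with which an automorphism acts on the vertices modulo commutators. -/
def signHom {c : V} (hF : Focused G c) (hT : TrivialAut G) : MulAut (RAAG G) →* (V → ℤˣ) :=
  MulEquiv.piUnits.toMonoidHom.comp (diagHom hF hT).toHomUnits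

theorem signHom_apply {c : V} (hF : Focused G c) (hT : TrivialAut G) (φ : MulAut (RAAG G))
    (v : V) : (signHom hF hT φ v : ℤ) = ex v (φ (gen G v)) := rfl

theorem signHom_surjective {c : V} (hF : Focused G c) (hT : TrivialAut G) :
    Function.Surjective (signHom hF hT) := by
  intro ε
  let F : RAAG G →* RAAG G := lift (fun v => gen G v ^ (ε v : ℤ)) fun u v h =>
    ((gen_commute h).zpow_left _).zpow_right _
  have hF1 : ∀ v, F (gen G v) = gen G v ^ (ε v : ℤ) := fun v => lift_gen _ _ _
  have hF2 : F.comp F = MonoidHom.id _ := by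
    refine hom_ext fun v => ?_
    rw [MonoidHom.comp_apply, hF1, map_zpow, hF1, ← zpow_mul, ← Units.val_mul,
      Int.units_mul_self]
    simp
  refine ⟨MonoidHom.toMulEquiv F F hF2 hF2, ?_⟩
  ext v
  rw [signHom_apply]
  change ex v (F (gen G v)) = _
  simp [hF1]

theorem inn_le_ker_signHom {c : V} (hF : Focused G c) (hT : TrivialAut G) :
    Inn (RAAG G) ≤ (signHom hF hT).ker := by
  rintro _ ⟨g, rfl⟩
  rw [MonoidHom.mem_ker]
  ext v
  rw [signHom_apply]
  simp

theorem trans_mem_ker_signHom {c : V} (hF : Focused G c) (hT : TrivialAut G)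
    (f : Multiplicative (weights G c)) : trans G c f ∈ (signHom hF hT).ker := by
  rw [MonoidHom.mem_ker]
  ext v
  rw [signHom_apply, trans_gen]
  by_cases hv : v = c
  · subst hv
    simp [f.toAdd.2.2.2 v (by simp)]
  · simp [ex_gen_ne (Ne.symm hv)]

theorem exists_trans_of_mem_ker {c : V} (hF : Focused G c) (hT : TrivialAut G)
    (hc : ((star G c)ᶜ : Set V).Nonempty) {φ : MulAut (RAAG G)} (hφ : φ ∈ (signHom hF hT).ker) :
    ∃ f, φ * trans G c f ∈ Inn (RAAG G) := by
  classical
  have hdiag : ∀ v, ex v (φ (gen G v)) = 1 := by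
    intro v
    rw [← signHom_apply hF hT, MonoidHom.mem_ker.1 hφ]
    rfl
  set b : V → ℤ := fun v => if v = c then 0 else ex c (φ (gen G v)) with hb
  let f : weights G c := ⟨(0, b), fun _ _ => rfl, fun _ _ _ _ _ => rfl, fun v hv => by
    by_contra h
    have hvc : v ≠ c := fun h' => h (by simp [hb, h'])
    simp only [hb, if_neg hvc] at h
    exact hv ⟨hvc, (eq_of_ex_ne_zero hF hT φ hvc.symm h).2⟩⟩
  set ψ := φ * trans G c (Multiplicative.ofAdd (-f)) with hψ
  have hgen : ∀ w v, ex w (ψ (gen G v)) = ex w (gen G v) := by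
    intro w v
    have h1 : ex w (ψ (gen G v)) = ex w (φ (gen G v)) - b v * ex w (φ (gen G c)) := by
      rw [hψ, MulAut.mul_apply, trans_gen]
      simp [f]
      ring
    have hoff : ∀ v, w ≠ v → w ≠ c → ex w (φ (gen G v)) = 0 := by
      intro v hwv hwc
      by_contra h
      exact hwc (eq_of_ex_ne_zero hF hT φ hwv h).1
    rw [h1]
    by_cases hwc : w = c
    · subst hwc
      rw [hdiag w, mul_one]
      by_cases hv : v = w
      · subst hv
        simp [hb, hdiag]
      · simp [hb, hv, ex_gen_ne hv]
    · rw [hoff c hwc hwc, mul_zero, sub_zero]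
      by_cases hv : w = v
      · subst hv
        simp [hdiag]
      · rw [hoff v hv hwc, ex_gen_ne (Ne.symm hv)]
  have hex : ∀ w g, ex w (ψ g) = ex w g := by
    intro w g
    rw [ex_mulAut_map]
    simp only [hgen]
    exact (ex_map (MonoidHom.id _) w g).symm
  obtain ⟨f', hf'⟩ := exists_trans_of_conj hF hc (φ := ψ) (exists_conj hF.1 hex)
  exact ⟨Multiplicative.ofAdd (-f) * f', by rwa [map_mul, ← mul_assoc]⟩

end Sign

section Outer

variable {V : Type} {G : SimpleGraph V} {c : V}

theorem of_trans_mem_inn {f : Multiplicative (weights G c)} (h : trans G c f ∈ Inn (RAAG G)) :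
    f.toAdd.1.2 = 0 ∧ ∃ n, ∀ v ∉ star G c, f.toAdd.1.1 v = n := by
  obtain ⟨p, hp⟩ := h
  have hgen : ∀ v, p * gen G v * p⁻¹ = gen G c ^ f.toAdd.1.1 v * gen G v *
      gen G c ^ (f.toAdd.1.2 v - f.toAdd.1.1 v) := by
    intro v
    rw [← trans_gen, ← hp, MulAut.conj_apply]
  have hb : ∀ v, f.toAdd.1.2 v = 0 := by
    intro v
    have := congrArg (ex c) (hgen v)
    simp only [ex_mul, ex_inv, ex_zpow, ex_gen_self] at this
    linarith
  refine ⟨funext hb, ex c p, fun v hv => ?_⟩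
  have hcomm : Commute (gen G v) ((gen G c ^ f.toAdd.1.1 v)⁻¹ * p) := by
    have h := hgen v
    rw [hb, zero_sub, zpow_neg] at h
    have h' : p * gen G v = gen G c ^ f.toAdd.1.1 v * gen G v * (gen G c ^ f.toAdd.1.1 v)⁻¹ * p :=
      by rw [← h]; group
    change _ = _
    rw [mul_assoc _ p, h']
    group
  have := ex_eq_zero_of_mem_sub (star_symm hv) (commute_gen_iff.1 hcomm)
  simp only [ex_mul, ex_inv, ex_zpow, ex_gen_self] at this
  linarith

theorem trans_mem_inn {f : Multiplicative (weights G c)} {n : ℤ} (hb : f.toAdd.1.2 = 0)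
    (ha : ∀ v ∉ star G c, f.toAdd.1.1 v = n) : trans G c f ∈ Inn (RAAG G) := by
  refine ⟨gen G c ^ n, aut_ext fun v => ?_⟩
  rw [MulAut.conj_apply, trans_gen, hb]
  by_cases hv : v ∈ star G c
  · have hc : Commute (gen G c) (gen G v) := by
      rcases hv with rfl | hv
      · exact Commute.refl _
      · exact gen_commute hv
    rw [f.toAdd.2.1 v hv, (hc.zpow_left n).eq]
    simp
  · rw [ha v hv]
    simp

/-- The components of the complement of the star of `c`. -/
abbrev Comps (G : SimpleGraph V) (c : V) := (G.induce (star G c)ᶜ).ConnectedComponent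

/-- The components other than a given one, together with the vertices dominated by `c`. -/
abbrev Params (C₀ : Comps G c) := {C : Comps G c // C ≠ C₀} ⊕ {v : V // v ≠ c ∧ Dominates G c v}

theorem card_params [Finite V] (C₀ : Comps G c) :
    Nat.card (Params C₀) = kInv G c + mInv G c - 1 := by
  classical
  have : Fintype V := Fintype.ofFinite V
  have : Finite (Comps G c) := Quot.finite _
  have : Fintype (Comps G c) := Fintype.ofFinite _
  have hpos : 0 < Fintype.card (Comps G c) := Fintype.card_pos_iff.2 ⟨C₀⟩
  have h : Nat.card {C : Comps G c // C ≠ C₀} = kInv G c - 1 := by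
    rw [kInv, Nat.card_eq_fintype_card, Nat.card_eq_fintype_card]
    simp
  rw [Nat.card_sum, h]
  have : 0 < kInv G c := by rwa [kInv, Nat.card_eq_fintype_card]
  have : Nat.card {v : V // v ≠ c ∧ Dominates G c v} = mInv G c := rfl
  omega

open Classical in
/-- The weights vanishing on the component `C₀` with given values elsewhere. -/
def paramWeights (C₀ : Comps G c) : (Params C₀ → ℤ) →+ weights G c where
  toFun h := ⟨(fun v => if hv : v ∈ (star G c)ᶜ then
      if hC : SimpleGraph.connectedComponentMk _ ⟨v, hv⟩ ≠ C₀ then h (.inl ⟨_, hC⟩) else 0 else 0,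
      fun v => if hv : v ≠ c ∧ Dominates G c v then h (.inr ⟨v, hv⟩) else 0),
    fun v hv => by simp [hv],
    fun v w hv hw hvw => by
      have : (G.induce (star G c)ᶜ).connectedComponentMk ⟨v, hv⟩ =
          (G.induce (star G c)ᶜ).connectedComponentMk ⟨w, hw⟩ :=
        SimpleGraph.ConnectedComponent.sound (SimpleGraph.Adj.reachable hvw)
      simp [hv, hw, this],
    fun v hv => dif_neg hv⟩
  map_zero' := by
    ext v <;> simp
  map_add' h h' := by
    ext v
    · simp only [AddSubgroup.coe_add, Prod.fst_add, Pi.add_apply]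
      split_ifs <;> simp
    · simp only [AddSubgroup.coe_add, Prod.snd_add, Pi.add_apply]
      split_ifs <;> simp

theorem paramWeights_fst (C₀ : Comps G c) (h : Params C₀ → ℤ) {v : V} (hv : v ∈ (star G c)ᶜ)
    (hC : SimpleGraph.connectedComponentMk _ ⟨v, hv⟩ ≠ C₀) :
    (paramWeights C₀ h).1.1 v = h (.inl ⟨_, hC⟩) :=
  (dif_pos hv).trans (dif_pos hC)

theorem paramWeights_fst_base {x : V} (hx : x ∈ (star G c)ᶜ)
    (h : Params (SimpleGraph.connectedComponentMk _ ⟨x, hx⟩ : Comps G c) → ℤ) :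
    (paramWeights _ h).1.1 x = 0 :=
  (dif_pos hx).trans (dif_neg (not_not.2 rfl))

theorem paramWeights_snd (C₀ : Comps G c) (h : Params C₀ → ℤ) {v : V}
    (hv : v ≠ c ∧ Dominates G c v) : (paramWeights C₀ h).1.2 v = h (.inr ⟨v, hv⟩) :=
  dif_pos hv

theorem weights_eq_of_connectedComponent_eq (f : weights G c) {v w : V} (hv : v ∈ (star G c)ᶜ)
    (hw : w ∈ (star G c)ᶜ) (h : (G.induce (star G c)ᶜ).connectedComponentMk ⟨v, hv⟩ =
      (G.induce (star G c)ᶜ).connectedComponentMk ⟨w, hw⟩) : f.1.1 v = f.1.1 w := by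
  obtain ⟨p⟩ := SimpleGraph.ConnectedComponent.exact h
  suffices ∀ a b (_ : (G.induce (star G c)ᶜ).Walk a b), f.1.1 a = f.1.1 b from this _ _ p
  intro a b p
  induction p with
  | nil => rfl
  | @cons a b _ hab _ ih => exact (f.2.2.1 _ _ a.2 b.2 hab).trans ih

/-- Outer automorphisms from weights vanishing on the component `C₀`. -/
def outHom (C₀ : Comps G c) : Multiplicative (Params C₀ → ℤ) →* Out (RAAG G) :=
  (QuotientGroup.mk' _).comp ((trans G c).comp (paramWeights C₀).toMultiplicative)

theorem outHom_apply (C₀ : Comps G c) (h : Multiplicative (Params C₀ → ℤ)) :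
    outHom C₀ h = (trans G c (.ofAdd (paramWeights C₀ h.toAdd)) : Out (RAAG G)) := rfl

theorem outHom_injective (C₀ : Comps G c) : Function.Injective (outHom C₀) := by
  rw [injective_iff_map_eq_one]
  intro h hh
  rw [outHom_apply, QuotientGroup.eq_one_iff] at hh
  obtain ⟨hb, n, ha⟩ := of_trans_mem_inn hh
  induction C₀ using SimpleGraph.ConnectedComponent.ind with | _ x
  have h0 : n = 0 := (ha x.1 x.2).symm.trans (paramWeights_fst_base x.2 h.toAdd)
  have : h.toAdd = 0 := by
    funext i
    rcases i with ⟨C, hC⟩ | ⟨v, hv⟩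
    · induction C using SimpleGraph.ConnectedComponent.ind with | _ v
      have := ha v.1 v.2
      rwa [toAdd_ofAdd, paramWeights_fst _ _ v.2 hC, h0] at this
    · have := congrFun hb v
      rwa [toAdd_ofAdd, paramWeights_snd _ _ hv] at this
  exact this

theorem exists_outHom_eq (C₀ : Comps G c) (f : weights G c) :
    ∃ h, outHom C₀ h = (trans G c (.ofAdd f) : Out (RAAG G)) := by
  induction C₀ using SimpleGraph.ConnectedComponent.ind with | _ x
  let h : Params ((G.induce (star G c)ᶜ).connectedComponentMk x) → ℤ :=
    Sum.elim (fun C => f.1.1 (Quot.out C.1 : ((star G c)ᶜ : Set V)) - f.1.1 x) fun v => f.1.2 v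
  refine ⟨.ofAdd h, ?_⟩
  rw [outHom_apply, QuotientGroup.eq, ← map_inv, ← map_mul]
  refine trans_mem_inn (n := f.1.1 x) ?_ ?_
  · funext v
    change -(paramWeights _ h).1.2 v + f.1.2 v = 0
    by_cases hv : v ≠ c ∧ Dominates G c v
    · rw [paramWeights_snd _ _ hv]
      exact neg_add_cancel _
    · rw [(paramWeights _ h).2.2.2 v hv, f.2.2.2 v hv]
      rfl
  · intro v hv
    change -(paramWeights _ h).1.1 v + f.1.1 v = f.1.1 x
    by_cases hC : (G.induce (star G c)ᶜ).connectedComponentMk ⟨v, hv⟩ =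
        (G.induce (star G c)ᶜ).connectedComponentMk x
    · rw [weights_eq_of_connectedComponent_eq (paramWeights _ h) hv x.2 hC,
        paramWeights_fst_base x.2, weights_eq_of_connectedComponent_eq f hv x.2 hC]
      simp
    · rw [paramWeights_fst _ _ hv hC]
      have : h (.inl ⟨_, hC⟩) = f.1.1 v - f.1.1 x := congrArg (· - f.1.1 x.1)
        (weights_eq_of_connectedComponent_eq f (Subtype.prop _) hv
          (Quot.out_eq ((G.induce (star G c)ᶜ).connectedComponentMk ⟨v, hv⟩)))
      rw [this]
      ring

variable [Fintype V]

/-- The signs with which an outer automorphism acts on the vertices modulo commutators. -/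
def outSignHom (hF : Focused G c) (hT : TrivialAut G) : Out (RAAG G) →* (V → ℤˣ) :=
  QuotientGroup.lift _ (signHom hF hT) (inn_le_ker_signHom hF hT)

theorem outSignHom_surjective (hF : Focused G c) (hT : TrivialAut G) :
    Function.Surjective (outSignHom hF hT) :=
  QuotientGroup.lift_surjective_of_surjective _ _ (signHom_surjective hF hT) _

theorem index_ker_outSignHom (hF : Focused G c) (hT : TrivialAut G) :
    (outSignHom hF hT).ker.index = 2 ^ Nat.card V := by
  classical
  rw [Subgroup.index_ker, MonoidHom.range_eq_top.2 (outSignHom_surjective hF hT),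
    Subgroup.card_top, Nat.card_eq_fintype_card, Nat.card_eq_fintype_card, Fintype.card_fun]
  rfl

theorem range_outHom (hF : Focused G c) (hT : TrivialAut G)
    (C₀ : Comps G c) : (outHom C₀).range = (outSignHom hF hT).ker := by
  ext φ
  refine ⟨?_, fun hφ => ?_⟩
  · rintro ⟨h, rfl⟩
    exact trans_mem_ker_signHom hF hT _
  · obtain ⟨φ, rfl⟩ := QuotientGroup.mk_surjective φ
    obtain ⟨f, hf⟩ := exists_trans_of_mem_ker hF hT (Set.nonempty_coe_sort.1 C₀.nonempty_supp.to_type) hφ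
    obtain ⟨h, hh⟩ := exists_outHom_eq C₀ f.toAdd
    refine ⟨h⁻¹, ?_⟩
    rw [map_inv, hh]
    exact inv_eq_of_mul_eq_one_left ((QuotientGroup.eq_one_iff _).2 hf)

end Outer

end RAAG

/-- For a focused graph, `Out(A_Γ)` has a normal subgroup of index `2^n` isomorphic to
`ℤ^{k+m-1}`; in particular it is virtually free abelian of rank `k + m - 1`. -/
theorem stmt19 {V : Type} [Fintype V] (G : SimpleGraph V) (c : V)
    (hF : Focused G c) (hT : TrivialAut G)
    (hne : ((star G c)ᶜ : Set V).Nonempty) :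
    ∃ H : Subgroup (Out (RAAG G)), H.Normal ∧ H.index = 2 ^ (Nat.card V) ∧
      Nonempty (H ≃* Multiplicative (Fin (kInv G c + mInv G c - 1) → ℤ)) := by
  obtain ⟨x, hx⟩ := hne
  let C₀ : RAAG.Comps G c := SimpleGraph.connectedComponentMk _ ⟨x, hx⟩
  have : Finite (RAAG.Comps G c) := Quot.finite _
  refine ⟨(RAAG.outSignHom hF hT).ker, inferInstance, RAAG.index_ker_outSignHom hF hT, ⟨?_⟩⟩
  have e : RAAG.Params C₀ ≃ Fin (kInv G c + mInv G c - 1) :=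
    Finite.equivFinOfCardEq (RAAG.card_params C₀)
  exact ((MonoidHom.ofInjective (RAAG.outHom_injective C₀)).trans
    (MulEquiv.subgroupCongr (RAAG.range_outHom hF hT C₀))).symm.trans
    (AddEquiv.toMultiplicative (AddEquiv.arrowCongr e (AddEquiv.refl ℤ)))
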